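/- arXiv:0801.0920 — 2 statements merged into one kernel-verified Lean document; each statement's English description precedes it below -/
import Mathlib

section
/- Let X be a finitely generated Λ-module (Λ = ℤ_ℓ[[T]]) with invariants ρ, μ, λ, and let Y ⊆ X be a Λ-submodule that is finitely generated over ℤ_ℓ. Then for any fixed sufficiently large m, the quotients Y_n = X/(∇_nX + (ω_n/ω_m)Y) are finite for n ≥ m and their orders ℓ^{y_n} satisfy y_n = ρ(n+1)ℓ^n + μℓ^n + λn + O(1), i.e., y_n − (ρ(n+1)ℓ^n + μℓ^n + λn) is eventually constant. -/
/-- The Iwasawa algebra `Λ = ℤ_ℓ[[T]]`. -/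
abbrev Lam (ℓ : ℕ) [Fact ℓ.Prime] := PowerSeries ℤ_[ℓ]

/-- A distinguished polynomial: monic, with all lower coefficients divisible by `ℓ`. -/
def IsDistinguishedAt {O : Type*} [CommRing O] (ℓ : ℕ) (f : Polynomial O) : Prop :=
  f.Monic ∧ ∀ i < f.natDegree, f.coeff i ∈ Ideal.span {(ℓ : O)}

/-- `ω_n = (1+T)^(ℓ^n) - 1`. -/
noncomputable def omegaIw (ℓ : ℕ) [Fact ℓ.Prime] (n : ℕ) : Lam ℓ :=
  (1 + PowerSeries.X) ^ (ℓ ^ n) - 1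

/-- The elementary `Λ`-module `Λ^ρ ⊕ (⊕_i Λ/f_iΛ) ⊕ (⊕_j Λ/ℓ^(m_j)Λ)`. -/
abbrev ElemMod (ℓ : ℕ) [Fact ℓ.Prime] (ρ : ℕ) {ι κ : Type}
    (f : ι → Polynomial ℤ_[ℓ]) (m : κ → ℕ) : Type :=
  (Fin ρ → Lam ℓ) × ((i : ι) → Lam ℓ ⧸ Ideal.span {((f i : Lam ℓ))}) ×
    ((j : κ) → Lam ℓ ⧸ Ideal.span {(ℓ : Lam ℓ) ^ (m j)})

/-- `∇_nN = ℓ^(n+1)N + ω_nN` for a submodule `N` of a `Λ`-module. -/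
noncomputable def nablaN (ℓ : ℕ) [Fact ℓ.Prime] {M : Type*} [AddCommGroup M]
    [Module (Lam ℓ) M] (n : ℕ) (N : Submodule (Lam ℓ) M) : Submodule (Lam ℓ) M :=
  (Ideal.span {(ℓ : Lam ℓ) ^ (n + 1)}) • N ⊔ (Ideal.span {omegaIw ℓ n}) • N

namespace IwAux

open Pointwise

/-- index of a submodule -/
noncomputable def idx {R E : Type*} [Ring R] [AddCommGroup E] [Module R E]
    (N : Submodule R E) : ℕ := N.toAddSubgroup.index

section Lam
variable (ℓ : ℕ) [hℓ : Fact ℓ.Prime]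

lemma natCast_eq_C : (ℓ : Lam ℓ) = PowerSeries.C (ℓ : ℤ_[ℓ]) := by simp

lemma ell_dvd_iff (g : Lam ℓ) :
    (ℓ : Lam ℓ) ∣ g ↔ PowerSeries.map (PadicInt.toZMod (p := ℓ)) g = 0 := by
  rw [natCast_eq_C]
  have key : ∀ a : ℤ_[ℓ], PadicInt.toZMod a = 0 ↔ (ℓ : ℤ_[ℓ]) ∣ a := by
    intro a
    rw [← RingHom.mem_ker, PadicInt.ker_toZMod, PadicInt.maximalIdeal_eq_span_p,
      Ideal.mem_span_singleton]
  constructor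
  · rintro ⟨h, rfl⟩
    ext i
    rw [PowerSeries.coeff_map, PowerSeries.coeff_C_mul, map_zero, key]
    exact dvd_mul_right _ _
  · intro h
    have : ∀ i, ∃ c, PowerSeries.coeff i g = ℓ * c := by
      intro i
      have := congrArg (PowerSeries.coeff i) h
      simp only [PowerSeries.coeff_map, map_zero] at this
      exact (key _).1 this
    choose c hc using this
    refine ⟨PowerSeries.mk c, ?_⟩
    ext i
    rw [PowerSeries.coeff_C_mul, PowerSeries.coeff_mk, hc]

lemma ell_prime : Prime (ℓ : Lam ℓ) := by
  refine ⟨?_, ?_, ?_⟩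
  · rw [natCast_eq_C]
    intro h
    have := congrArg (PowerSeries.coeff 0) h
    simp at this
    exact hℓ.out.ne_zero this
  · intro h
    have := (ell_dvd_iff ℓ 1).1 (isUnit_iff_dvd_one.1 h)
    simp at this
  · intro a b h
    rw [ell_dvd_iff] at *
    rw [ell_dvd_iff]
    rw [map_mul] at h
    exact mul_eq_zero.1 h

lemma distinguished_iff (g : Polynomial ℤ_[ℓ]) (hg : IsDistinguishedAt ℓ g) :
    g.IsDistinguishedAt (IsLocalRing.maximalIdeal ℤ_[ℓ]) := by
  refine ⟨⟨?_⟩, hg.1⟩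
  intro n hn
  rw [PadicInt.maximalIdeal_eq_span_p]
  exact hg.2 n hn

lemma monic_not_dvd (g : Polynomial ℤ_[ℓ]) (hg : g.Monic) : ¬ (ℓ : Lam ℓ) ∣ (g : Lam ℓ) := by
  rw [ell_dvd_iff]
  intro h
  have := congrArg (PowerSeries.coeff g.natDegree) h
  simp [hg] at this

lemma exists_equiv (g : Polynomial ℤ_[ℓ]) (hg : IsDistinguishedAt ℓ g) :
    Nonempty ((Lam ℓ ⧸ Ideal.span {(g : Lam ℓ)}) ≃ₗ[ℤ_[ℓ]] (Fin g.natDegree → ℤ_[ℓ])) := by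
  have e1 := ((distinguished_iff ℓ g hg).algEquivQuotient).toLinearEquiv
  have e2 := (AdjoinRoot.powerBasis' hg.1).basis.equivFun
  have h : (AdjoinRoot.powerBasis' hg.1).dim = g.natDegree := rfl
  rw [h] at e2
  exact ⟨e1.symm.trans e2⟩

lemma idx_pow_Zp (k : ℕ) : idx (((ℓ : ℤ_[ℓ]) ^ k) • (⊤ : Submodule ℤ_[ℓ] ℤ_[ℓ])) = ℓ ^ k := by
  have h : (((ℓ : ℤ_[ℓ]) ^ k) • (⊤ : Submodule ℤ_[ℓ] ℤ_[ℓ])) =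
      RingHom.ker (PadicInt.toZModPow (p := ℓ) k) := by
    rw [PadicInt.ker_toZModPow]
    ext x
    rw [Submodule.mem_smul_pointwise_iff_exists, Ideal.mem_span_singleton]
    constructor
    · rintro ⟨b, -, rfl⟩
      exact ⟨b, rfl⟩
    · rintro ⟨b, rfl⟩
      exact ⟨b, trivial, rfl⟩
  rw [h, idx]
  have : (RingHom.ker (PadicInt.toZModPow (p := ℓ) k)).toAddSubgroup =
    (PadicInt.toZModPow (p := ℓ) k).toAddMonoidHom.ker := rfl
  rw [this, AddSubgroup.index_ker, AddMonoidHom.range_eq_top.2]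
  · simp
  · exact ZMod.ringHom_surjective _

lemma idx_pi_smul {R ι : Type*} [CommRing R] [Fintype ι] {N : ι → Type*}
    [∀ i, AddCommGroup (N i)] [∀ i, Module R (N i)] (S : ∀ i, Submodule R (N i)) :
    idx (Submodule.pi Set.univ S) = ∏ i, idx (S i) := by
  classical
  have : ∀ i, idx (S i) = Nat.card (N i ⧸ S i) := fun i => rfl
  simp_rw [this]
  rw [← Nat.card_pi]
  exact Nat.card_congr (Submodule.quotientPi S).toEquiv

lemma smul_top_pi {R ι : Type*} [CommRing R] {N : ι → Type*}
    [∀ i, AddCommGroup (N i)] [∀ i, Module R (N i)] (r : R) :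
    r • (⊤ : Submodule R (∀ i, N i)) = Submodule.pi Set.univ (fun i => r • (⊤ : Submodule R (N i))) := by
  ext x
  simp only [Submodule.mem_pi, Submodule.mem_smul_pointwise_iff_exists]
  constructor
  · rintro ⟨b, -, rfl⟩ i -
    exact ⟨b i, trivial, rfl⟩
  · intro h
    choose b hb hb' using fun i => h i trivial
    exact ⟨b, trivial, funext hb'⟩

lemma idx_quot_ell (g : Polynomial ℤ_[ℓ]) (hg : IsDistinguishedAt ℓ g) (k : ℕ) :
    idx (((ℓ : Lam ℓ) ^ k) • (⊤ : Submodule (Lam ℓ) (Lam ℓ ⧸ Ideal.span {(g : Lam ℓ)}))) =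
      ℓ ^ (k * g.natDegree) := by
  obtain ⟨e⟩ := exists_equiv ℓ g hg
  have h1 : idx (((ℓ : ℤ_[ℓ]) ^ k) • (⊤ : Submodule ℤ_[ℓ] (Fin g.natDegree → ℤ_[ℓ]))) =
      ℓ ^ (k * g.natDegree) := by
    rw [smul_top_pi, idx_pi_smul]
    simp [idx_pow_Zp, pow_mul]
  rw [← h1, idx, idx]
  have : (((ℓ : Lam ℓ) ^ k) • (⊤ : Submodule (Lam ℓ) (Lam ℓ ⧸ Ideal.span {(g : Lam ℓ)}))).toAddSubgroup
     = (((ℓ : ℤ_[ℓ]) ^ k) • (⊤ : Submodule ℤ_[ℓ] (Fin g.natDegree → ℤ_[ℓ]))).toAddSubgroup.comap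
        e.toLinearMap.toAddMonoidHom := by
    ext x
    simp only [AddSubgroup.mem_comap, Submodule.mem_toAddSubgroup,
      Submodule.mem_smul_pointwise_iff_exists]
    constructor
    · rintro ⟨b, -, rfl⟩
      refine ⟨e b, trivial, ?_⟩
      have : ((ℓ : Lam ℓ) ^ k) • b = ((ℓ : ℤ_[ℓ]) ^ k) • b := by
        rw [← Nat.cast_pow, ← Nat.cast_pow, Nat.cast_smul_eq_nsmul, Nat.cast_smul_eq_nsmul]
      rw [this]
      exact (map_smul e _ _).symm
    · rintro ⟨b, -, h⟩
      refine ⟨e.symm b, trivial, ?_⟩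
      have : ((ℓ : Lam ℓ) ^ k) • e.symm b = ((ℓ : ℤ_[ℓ]) ^ k) • e.symm b := by
        rw [← Nat.cast_pow, ← Nat.cast_pow, Nat.cast_smul_eq_nsmul, Nat.cast_smul_eq_nsmul]
      rw [this, ← map_smul, h]
      exact e.symm_apply_apply x
  rw [this, AddSubgroup.index_comap_of_surjective]
  exact e.surjective

lemma ell_inj_quot (g : Polynomial ℤ_[ℓ]) (hg : IsDistinguishedAt ℓ g)
    (x : Lam ℓ ⧸ Ideal.span {(g : Lam ℓ)}) (hx : (ℓ : Lam ℓ) • x = 0) : x = 0 := by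
  obtain ⟨e⟩ := exists_equiv ℓ g hg
  rw [Nat.cast_smul_eq_nsmul] at hx
  have : ℓ • e x = 0 := by rw [← map_nsmul, hx, map_zero]
  have h2 : e x = 0 := by
    funext i
    have := congrFun this i
    simpa [hℓ.out.ne_zero] using this
  exact (LinearEquiv.map_eq_zero_iff e).1 h2

lemma idx_sup (r s : Lam ℓ) :
    idx (r • (⊤ : Submodule (Lam ℓ) (Lam ℓ)) ⊔ s • (⊤ : Submodule (Lam ℓ) (Lam ℓ))) =
      idx (r • (⊤ : Submodule (Lam ℓ) (Lam ℓ ⧸ Ideal.span {s}))) := by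
  rw [idx, idx, ← AddSubgroup.index_comap_of_surjective (f := (Ideal.span {s}).mkQ.toAddMonoidHom)
    _ (Submodule.mkQ_surjective _)]
  congr 1
  ext x
  simp only [AddSubgroup.mem_comap, Submodule.mem_toAddSubgroup,
      Submodule.mem_smul_pointwise_iff_exists, Submodule.mem_sup]
  constructor
  · rintro ⟨_, ⟨b, -, rfl⟩, _, ⟨c, -, rfl⟩, rfl⟩
    refine ⟨(Ideal.span {s}).mkQ b, trivial, ?_⟩
    rw [← map_smul]
    refine (Submodule.Quotient.eq _).2 ?_
    rw [Ideal.mem_span_singleton]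
    exact ⟨-c, by simp⟩
  · rintro ⟨b, -, h⟩
    obtain ⟨b, rfl⟩ := Submodule.mkQ_surjective _ b
    rw [← map_smul] at h
    have := (Submodule.Quotient.eq _).1 h
    rw [Ideal.mem_span_singleton] at this
    obtain ⟨c, hc⟩ := this
    refine ⟨r • b, ⟨b, trivial, rfl⟩, s • (-c), ⟨-c, trivial, rfl⟩, ?_⟩
    simp only [smul_eq_mul] at *
    linear_combination hc

/-- polynomial version of omega -/
noncomputable def omegaPoly (n : ℕ) : Polynomial ℤ_[ℓ] := (1 + Polynomial.X) ^ (ℓ ^ n) - 1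

lemma omegaPoly_coe (n : ℕ) : ((omegaPoly ℓ n : Polynomial ℤ_[ℓ]) : Lam ℓ) = omegaIw ℓ n := by
  simp [omegaPoly, omegaIw]

lemma omegaPoly_natDegree (n : ℕ) : (omegaPoly ℓ n).natDegree = ℓ ^ n ∧ (omegaPoly ℓ n).Monic := by
  have hpos : 0 < ℓ ^ n := pow_pos hℓ.out.pos n
  have h1 : ((1 + Polynomial.X : Polynomial ℤ_[ℓ]) ^ (ℓ ^ n)).natDegree = ℓ ^ n := by
    rw [add_comm, ← Polynomial.C_1, Polynomial.natDegree_pow_X_add_C]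
  have h2 : ((1 + Polynomial.X : Polynomial ℤ_[ℓ]) ^ (ℓ ^ n)).Monic := by
    rw [add_comm, ← Polynomial.C_1]
    exact (Polynomial.monic_X_add_C 1).pow _
  have hd : (1 : Polynomial ℤ_[ℓ]).degree < ((1 + Polynomial.X : Polynomial ℤ_[ℓ]) ^ (ℓ ^ n)).degree := by
    rw [Polynomial.degree_one, Polynomial.degree_eq_natDegree h2.ne_zero, h1]
    exact_mod_cast hpos
  refine ⟨?_, ?_⟩
  · rw [omegaPoly, Polynomial.natDegree_sub_eq_left_of_natDegree_lt, h1]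
    rw [h1]; simpa using hpos
  · exact h2.sub_of_left hd

lemma omegaPoly_dist (n : ℕ) : IsDistinguishedAt ℓ (omegaPoly ℓ n) := by
  refine ⟨(omegaPoly_natDegree ℓ n).2, ?_⟩
  rw [(omegaPoly_natDegree ℓ n).1]
  intro i hi
  rw [← PadicInt.maximalIdeal_eq_span_p, ← PadicInt.ker_toZMod, RingHom.mem_ker,
    ← Polynomial.coeff_map]
  have : Polynomial.map (PadicInt.toZMod (p := ℓ)) (omegaPoly ℓ n) = Polynomial.X ^ (ℓ ^ n) := by
    simp [omegaPoly, add_pow_char_pow]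
  rw [this, Polynomial.coeff_X_pow, if_neg hi.ne]

lemma omega_not_dvd (n : ℕ) : ¬ (ℓ : Lam ℓ) ∣ omegaIw ℓ n := by
  rw [← omegaPoly_coe]
  exact monic_not_dvd ℓ _ (omegaPoly_dist ℓ n).1

lemma idx_nabla (k n : ℕ) :
    idx ((ℓ : Lam ℓ) ^ k • (⊤ : Submodule (Lam ℓ) (Lam ℓ)) ⊔
      omegaIw ℓ n • (⊤ : Submodule (Lam ℓ) (Lam ℓ))) = ℓ ^ (k * ℓ ^ n) := by
  rw [idx_sup, ← omegaPoly_coe, idx_quot_ell ℓ _ (omegaPoly_dist ℓ n), (omegaPoly_natDegree ℓ n).1]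

lemma idx_mu (k n : ℕ) :
    idx (omegaIw ℓ n • (⊤ : Submodule (Lam ℓ) (Lam ℓ ⧸ Ideal.span {(ℓ : Lam ℓ) ^ k}))) =
      ℓ ^ (k * ℓ ^ n) := by
  rw [← idx_sup, sup_comm, idx_nabla]

end Lam

section Lam2
variable (ℓ : ℕ) [hℓ : Fact ℓ.Prime]

/-- quotient of consecutive omegas -/
noncomputable def theta (n : ℕ) : Lam ℓ := ∑ i ∈ Finset.range ℓ, ((1 + PowerSeries.X) ^ (ℓ ^ n)) ^ i

/-- maximal ideal -/
noncomputable def mm : Ideal (Lam ℓ) := Ideal.span {(ℓ : Lam ℓ), PowerSeries.X}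

lemma ell_mem : (ℓ : Lam ℓ) ∈ mm ℓ := Ideal.subset_span (by simp)
lemma X_mem : (PowerSeries.X : Lam ℓ) ∈ mm ℓ := Ideal.subset_span (by simp)

lemma omega_succ (n : ℕ) : omegaIw ℓ (n + 1) = omegaIw ℓ n * theta ℓ n := by
  rw [omegaIw, omegaIw, theta, mul_comm, geom_sum_mul, ← pow_mul, ← pow_succ]

lemma theta_sub (n : ℕ) : ∃ g, theta ℓ n = ℓ + omegaIw ℓ n * g := by
  have : omegaIw ℓ n ∣ theta ℓ n - ℓ := by
    have h : theta ℓ n - ℓ = ∑ i ∈ Finset.range ℓ, (((1 + PowerSeries.X : Lam ℓ) ^ (ℓ ^ n)) ^ i - 1) := by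
      rw [Finset.sum_sub_distrib, theta]; simp
    rw [h]
    refine Finset.dvd_sum fun i _ => ?_
    rw [omegaIw]
    exact sub_one_dvd_pow_sub_one _ _
  obtain ⟨g, hg⟩ := this
  exact ⟨g, by rw [← hg]; ring⟩

lemma omega_mem (n : ℕ) : omegaIw ℓ n ∈ mm ℓ ^ (n + 1) := by
  induction n with
  | zero => simpa [omegaIw] using X_mem ℓ
  | succ n ih =>
    rw [omega_succ, pow_succ]
    refine Ideal.mul_mem_mul ih ?_
    obtain ⟨g, hg⟩ := theta_sub ℓ n
    rw [hg]
    exact add_mem (ell_mem ℓ) (Ideal.mul_mem_right _ _ (Ideal.pow_le_self (by omega) ih))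

lemma isUnit_one_sub (c : Lam ℓ)
    (hc : PowerSeries.constantCoeff c ∈ IsLocalRing.maximalIdeal ℤ_[ℓ]) : IsUnit (1 - c) := by
  rw [PowerSeries.isUnit_iff_constantCoeff, map_sub, map_one]
  exact IsLocalRing.isUnit_one_sub_self_of_mem_nonunits _ hc

lemma isUnit_one_add_ell (v : Lam ℓ) : IsUnit (1 + ℓ * v) := by
  have := isUnit_one_sub ℓ (ℓ * (-v)) (by
    rw [map_mul]
    refine Ideal.mul_mem_right _ _ ?_
    rw [PadicInt.maximalIdeal_eq_span_p, map_natCast]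
    exact Ideal.mem_span_singleton_self _)
  simpa using this

lemma mm_pow_le (I : Ideal (Lam ℓ)) (h1 : (ℓ : Lam ℓ) ∈ I.radical)
    (h2 : (PowerSeries.X : Lam ℓ) ∈ I.radical) : ∃ k, mm ℓ ^ k ≤ I := by
  refine Ideal.exists_pow_le_of_le_radical_of_fg ?_ ?_
  · rw [mm, Ideal.span_le]
    rintro x (rfl | rfl) <;> assumption
  · exact Submodule.fg_span (by simp)

lemma finite_killed {N : Type*} [AddCommGroup N] [Module (Lam ℓ) N] [Finite N] :
    ∃ k, ∀ r ∈ mm ℓ ^ k, ∀ x : N, r • x = 0 := by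
  have key : ∀ r : Lam ℓ, PowerSeries.constantCoeff r ∈ IsLocalRing.maximalIdeal ℤ_[ℓ] →
      r ∈ (Module.annihilator (Lam ℓ) N).radical := by
    intro r hr
    obtain ⟨a, b, hab, h⟩ := Finite.exists_ne_map_eq_of_infinite
      (fun n : ℕ => (fun x : N => r ^ n • x))
    wlog hlt : a < b generalizing a b
    · exact this b a hab.symm h.symm (by omega)
    obtain ⟨j, rfl⟩ := Nat.exists_eq_add_of_lt hlt
    refine ⟨a, ?_⟩
    rw [Module.mem_annihilator]
    intro x
    have hx : (1 - r ^ (j + 1)) • (r ^ a • x) = 0 := by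
      have := congrFun h x
      rw [sub_smul, one_smul, smul_smul, ← pow_add, this, sub_eq_zero]
      congr 2; ring
    have hu := isUnit_one_sub ℓ (r ^ (j + 1)) (by
      rw [map_pow]
      exact Ideal.pow_mem_of_mem _ hr _ (by omega))
    exact (IsUnit.smul_eq_zero hu).1 hx
  obtain ⟨k, hk⟩ := mm_pow_le ℓ (Module.annihilator (Lam ℓ) N)
    (key _ (by
      rw [PadicInt.maximalIdeal_eq_span_p, map_natCast]
      exact Ideal.mem_span_singleton_self _)) (key _ (by simp))
  exact ⟨k, fun r hr x => Module.mem_annihilator.1 (hk hr) x⟩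

lemma dist_prod {ι : Type*} [Fintype ι] (f : ι → Polynomial ℤ_[ℓ])
    (hf : ∀ i, IsDistinguishedAt ℓ (f i)) :
    (∏ i, f i).IsDistinguishedAt (IsLocalRing.maximalIdeal ℤ_[ℓ]) := by
  refine Finset.prod_induction f (fun g => g.IsDistinguishedAt (IsLocalRing.maximalIdeal ℤ_[ℓ]))
    (fun a b => Polynomial.IsDistinguishedAt.mul) ?_ (fun i _ => distinguished_iff ℓ _ (hf i))
  refine ⟨⟨?_⟩, Polynomial.monic_one⟩
  intro n hn
  simp at hn

lemma exists_mm_pow (F : Polynomial ℤ_[ℓ])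
    (hF : F.IsDistinguishedAt (IsLocalRing.maximalIdeal ℤ_[ℓ])) :
    ∃ k, mm ℓ ^ k ≤ Ideal.span {(ℓ : Lam ℓ) ^ 2, (F : Lam ℓ)} := by
  have hd : (ℓ : Lam ℓ) ∣ (F : Lam ℓ) - (PowerSeries.X : Lam ℓ) ^ F.natDegree := by
    rw [ell_dvd_iff]
    ext i
    rw [PowerSeries.coeff_map, map_sub, map_zero, ← RingHom.mem_ker, PadicInt.ker_toZMod,
      Polynomial.coeff_coe, PowerSeries.coeff_X_pow]
    split_ifs with h
    · subst h
      simp [hF.monic]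
    · rw [sub_zero]
      rcases lt_or_gt_of_ne h with h | h
      · exact hF.mem h
      · rw [Polynomial.coeff_eq_zero_of_natDegree_lt h]; exact zero_mem _
  obtain ⟨g, hg⟩ := hd
  refine mm_pow_le ℓ _ ⟨2, Ideal.subset_span (by simp)⟩ ⟨F.natDegree * 2, ?_⟩
  rw [Ideal.mem_span_pair]
  refine ⟨g ^ 2, F - 2 * ℓ * g, ?_⟩
  have : (PowerSeries.X : Lam ℓ) ^ F.natDegree = F - ℓ * g := by rw [← hg]; ring
  rw [pow_mul, this]; ring

lemma exists_theta (F : Polynomial ℤ_[ℓ])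
    (hF : F.IsDistinguishedAt (IsLocalRing.maximalIdeal ℤ_[ℓ])) :
    ∃ k, ∀ n ≥ k, ∃ u, IsUnit u ∧ (F : Lam ℓ) ∣ theta ℓ n - ℓ * u := by
  obtain ⟨k, hk⟩ := exists_mm_pow ℓ F hF
  refine ⟨k, fun n hn => ?_⟩
  obtain ⟨g, hg⟩ := theta_sub ℓ n
  have h := hk (Ideal.pow_le_pow_right (by omega : k ≤ n + 1) (omega_mem ℓ n))
  rw [Ideal.mem_span_pair] at h
  obtain ⟨a, b, h⟩ := h
  refine ⟨1 + ℓ * (a * g), isUnit_one_add_ell ℓ _, b * g, ?_⟩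
  rw [hg, ← h]; ring

lemma exists_Theta (F : Polynomial ℤ_[ℓ])
    (hF : F.IsDistinguishedAt (IsLocalRing.maximalIdeal ℤ_[ℓ])) :
    ∃ k, ∀ n₁ ≥ k, ∀ j, ∃ Θ u, IsUnit u ∧ omegaIw ℓ (n₁ + j) = omegaIw ℓ n₁ * Θ ∧
      (F : Lam ℓ) ∣ Θ - ℓ ^ j * u := by
  obtain ⟨k, hk⟩ := exists_theta ℓ F hF
  refine ⟨k, fun n₁ hn j => ?_⟩
  induction j with
  | zero => exact ⟨1, 1, isUnit_one, by simp, by simp⟩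
  | succ j ih =>
    obtain ⟨Θ, u, hu, h1, c, h2⟩ := ih
    obtain ⟨v, hv, d, h3⟩ := hk (n₁ + j) (by omega)
    refine ⟨Θ * theta ℓ (n₁ + j), u * v, hu.mul hv, ?_, c * theta ℓ (n₁ + j) + ℓ ^ j * u * d, ?_⟩
    · rw [← add_assoc, omega_succ, h1, mul_assoc]
    · linear_combination theta ℓ (n₁ + j) * h2 + ℓ ^ j * u * h3

lemma omega_ne_zero (n : ℕ) : omegaIw ℓ n ≠ 0 := fun h => omega_not_dvd ℓ n (h ▸ dvd_zero _)

lemma omega_dvd (n j : ℕ) : ∃ q, omegaIw ℓ (n + j) = omegaIw ℓ n * q := by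
  induction j with
  | zero => exact ⟨1, by simp⟩
  | succ j ih =>
    obtain ⟨q, hq⟩ := ih
    exact ⟨q * theta ℓ (n + j), by rw [← add_assoc, omega_succ, hq, mul_assoc]⟩

lemma exists_killer {Y : Type*} [AddCommGroup Y] [Module (Lam ℓ) Y] [Module ℤ_[ℓ] Y]
    [IsScalarTower ℤ_[ℓ] (Lam ℓ) Y] [Module.Finite ℤ_[ℓ] Y] :
    ∃ p : Polynomial ℤ_[ℓ], p.Monic ∧ ∀ y : Y, (p : Lam ℓ) • y = 0 := by
  obtain ⟨p, hp, h⟩ := Algebra.IsIntegral.isIntegral (R := ℤ_[ℓ])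
    (Algebra.lsmul ℤ_[ℓ] ℤ_[ℓ] Y (PowerSeries.X : Lam ℓ))
  refine ⟨p, hp, fun y => ?_⟩
  rw [← Polynomial.aeval_def, Polynomial.aeval_algHom_apply] at h
  have h2 : Polynomial.aeval (PowerSeries.X : Lam ℓ) p = p := by
    have h3 : Polynomial.aeval (PowerSeries.X : Lam ℓ) =
        Polynomial.coeToPowerSeries.algHom (R := ℤ_[ℓ]) ℤ_[ℓ] := by
      apply Polynomial.algHom_ext
      simp [Polynomial.coeToPowerSeries.algHom_apply]
    rw [h3, Polynomial.coeToPowerSeries.algHom_apply]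
    simp
  rw [h2] at h
  exact congrArg (fun g => g y) h

/-- vanishing of coprime combos -/
lemma omega_ell_coprime (k n : ℕ) (a b : Lam ℓ) (h : (ℓ : Lam ℓ) ^ k * a + omegaIw ℓ n * b = 0) :
    ∃ c, a = omegaIw ℓ n * c ∧ b = - (ℓ ^ k * c) := by
  have h1 : (ℓ : Lam ℓ) ^ k ∣ b := by
    refine (ell_prime ℓ).pow_dvd_of_dvd_mul_left k (omega_not_dvd ℓ n) ⟨-a, ?_⟩
    linear_combination h
  obtain ⟨c, rfl⟩ := h1
  refine ⟨-c, ?_, by ring⟩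
  have : (ℓ : Lam ℓ) ^ k * (a + omegaIw ℓ n * c) = 0 := by linear_combination h
  have := (mul_eq_zero.1 this).resolve_left (pow_ne_zero _ (ell_prime ℓ).ne_zero)
  linear_combination this

lemma quot_ell_inj (k : ℕ) (r : Lam ℓ) (hr : ¬ (ℓ : Lam ℓ) ∣ r)
    (x : Lam ℓ ⧸ Ideal.span {(ℓ : Lam ℓ) ^ k}) (hx : r • x = 0) : x = 0 := by
  obtain ⟨x, rfl⟩ := Submodule.mkQ_surjective _ x
  rw [← map_smul] at hx
  have h1 := (Submodule.Quotient.mk_eq_zero _).1 hx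
  refine (Submodule.Quotient.mk_eq_zero _).2 ?_
  rw [Ideal.mem_span_singleton] at *
  exact (ell_prime ℓ).pow_dvd_of_dvd_mul_left k hr h1

end Lam2

section Abs

variable {R : Type*} [CommRing R]

lemma idx_smul_inj {E : Type*} [AddCommGroup E] [Module R E] (r : R)
    (hr : ∀ x : E, r • x = 0 → x = 0) (N : Submodule R E) :
    idx (r • N) = idx N * idx (r • (⊤ : Submodule R E)) := by
  have h := AddSubgroup.index_map_of_injective (N.toAddSubgroup)
    (f := (LinearMap.lsmul R E r).toAddMonoidHom)
    ((injective_iff_map_eq_zero _).2 hr)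
  have h1 : (r • N).toAddSubgroup = N.toAddSubgroup.map (LinearMap.lsmul R E r).toAddMonoidHom := by
    ext x
    rfl
  have h2 : (r • (⊤ : Submodule R E)).toAddSubgroup =
      (LinearMap.lsmul R E r).toAddMonoidHom.range := by
    ext x
    constructor
    · rintro ⟨b, -, rfl⟩
      exact ⟨b, rfl⟩
    · rintro ⟨b, rfl⟩
      exact ⟨b, trivial, rfl⟩
  rw [idx, idx, idx, h1, h2, h]

lemma idx_prod {E G : Type*} [AddCommGroup E] [Module R E] [AddCommGroup G] [Module R G]
    (N : Submodule R E) (P : Submodule R G) : idx (N.prod P) = idx N * idx P :=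
  AddSubgroup.index_prod N.toAddSubgroup P.toAddSubgroup

lemma idx_ne_zero_of_le {E : Type*} [AddCommGroup E] [Module R E]
    {N P : Submodule R E} (h : N ≤ P) (hN : idx N ≠ 0) : idx P ≠ 0 := by
  intro hP
  have := AddSubgroup.index_dvd_of_le (H := N.toAddSubgroup) (K := P.toAddSubgroup) h
  rw [idx] at hN hP
  rw [hP] at this
  exact hN (zero_dvd_iff.1 this)

variable {V L M : Type*} [AddCommGroup V] [Module R V] [AddCommGroup L] [Module R L]
  [AddCommGroup M] [Module R M]

/-- explicit relation module -/
def S0 (YE : Submodule R (V × L × M)) (p₁ w₁ q₁ : R) :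
    Submodule R ((V × L × M) × (V × L × M)) where
  carrier := {z | z.1.1 = 0 ∧ z.2.1 = 0 ∧ z.2.2.2 = 0 ∧
    ∃ y ∈ YE, p₁ • z.1.2.1 + w₁ • z.2.2.1 = q₁ • y.2.1}
  zero_mem' := ⟨rfl, rfl, rfl, 0, zero_mem _, by simp⟩
  add_mem' := by
    rintro a b ⟨h1, h2, h3, y, hy, h4⟩ ⟨k1, k2, k3, y', hy', k4⟩
    refine ⟨by simp [h1, k1], by simp [h2, k2], by simp [h3, k3], y + y', add_mem hy hy', ?_⟩
    simp only [Prod.fst_add, Prod.snd_add, smul_add, ← h4, ← k4]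
    abel
  smul_mem' := by
    rintro c a ⟨h1, h2, h3, y, hy, h4⟩
    refine ⟨by simp [h1], by simp [h2], by simp [h3], c • y, Submodule.smul_mem _ _ hy, ?_⟩
    simp only [Prod.smul_fst, Prod.smul_snd, smul_comm _ c, ← h4, smul_add]

lemma idx_comap_surj {E G : Type*} [AddCommGroup E] [Module R E] [AddCommGroup G] [Module R G]
    (φ : E →ₗ[R] G) (hφ : Function.Surjective φ) (N : Submodule R G) :
    idx (N.comap φ) = idx N :=
  AddSubgroup.index_comap_of_surjective N.toAddSubgroup (f := φ.toAddMonoidHom) hφ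

lemma idx_rel {E G : Type*} [AddCommGroup E] [Module R E] [AddCommGroup G] [Module R G]
    {W D : Submodule R G} (h : W ≤ D) (φ : E →ₗ[R] G) (hD : D = W ⊔ LinearMap.range φ) :
    idx W = idx (W.comap φ) * idx D := by
  have h1 : idx W = W.toAddSubgroup.relIndex D.toAddSubgroup * idx D :=
    (AddSubgroup.relIndex_mul_index (H := W.toAddSubgroup) (K := D.toAddSubgroup) h).symm
  have hDW : D.toAddSubgroup = W.toAddSubgroup ⊔ φ.toAddMonoidHom.range := by
    have hr : φ.toAddMonoidHom.range = (LinearMap.range φ).toAddSubgroup := by ext x; rfl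
    rw [hr, ← Submodule.sup_toAddSubgroup, ← hD]
  rw [h1, hDW, AddSubgroup.relIndex_sup_left, ← AddSubgroup.index_comap]
  rfl

lemma mem_W_iff (E' YE : Submodule R (V × L × M)) (p w q p₁ w₁ q₁ e u : R)
    (hY : ∀ y ∈ YE, y.1 = 0 ∧ y.2.2 = 0)
    (hp : p = e * p₁) (hw : ∀ x : L, w • x = (e * u) • w₁ • x)
    (hq : ∀ x : L, q • x = (e * u) • q₁ • x) (he : ∀ x : L, e • x = 0 → x = 0)
    (hu : IsUnit u)
    (hV : ∀ a b : V, p • a + w • b = 0 → ∃ c, a = w • c ∧ b = - (p • c))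
    (hpM : ∀ x : M, p • x = 0) (hwM : ∀ x : M, w • x = 0 → x = 0)
    (hpE : ∀ x : V × L × M, p • x ∈ E') (hwE : ∀ x : V × L × M, w • x ∈ E')
    (a b : V × L × M) : p • a + w • b ∈ p • E' ⊔ w • E' ⊔ q • YE ↔
      (a, u • b) ∈ E'.prod E' ⊔ S0 YE p₁ w₁ q₁ := by
  obtain ⟨u', rfl⟩ := hu
  constructor
  · intro h
    obtain ⟨z, hz, _, ⟨y, hy, rfl⟩, h⟩ := Submodule.mem_sup.1 h
    obtain ⟨_, ⟨a', ha', rfl⟩, _, ⟨b', hb', rfl⟩, rfl⟩ := Submodule.mem_sup.1 hz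
    obtain ⟨α, rfl⟩ : ∃ α, a = a' + α := ⟨a - a', by abel⟩
    obtain ⟨β, rfl⟩ : ∃ β, b = b' + β := ⟨b - b', by abel⟩
    have h' : p • α + w • β = q • y := by
      have : p • a' + w • b' + q • y = p • (a' + α) + w • (b' + β) := h
      rw [smul_add, smul_add] at this
      have h3 : p • a' + w • b' + q • y = p • a' + w • b' + (p • α + w • β) := by
        rw [this]; abel
      exact (add_left_cancel h3).symm
    obtain ⟨hy1, hy2⟩ := hY y hy
    have e1 : p • α.1 + w • β.1 = 0 := by
      have := congrArg Prod.fst h'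
      simpa [hy1] using this
    have e2 : p • α.2.1 + w • β.2.1 = q • y.2.1 := congrArg (fun z => z.2.1) h'
    have e3 : w • β.2.2 = 0 := by
      have := congrArg (fun z => z.2.2) h'
      simpa [hy2, hpM] using this
    obtain ⟨c, hc1, hc2⟩ := hV _ _ e1
    have e4 := hwM _ e3
    have hcE : (w • c, (0 : L), (0 : M)) ∈ E' := by simpa using hwE (c, 0, 0)
    have hcE' : (-(p • c), (0 : L), (0 : M)) ∈ E' := by simpa using neg_mem (hpE (c, 0, 0))
    refine Submodule.mem_sup.2 ⟨(a' + (w • c, 0, 0), (u' : R) • (b' + (-(p • c), 0, 0))),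
      ⟨add_mem ha' hcE, Submodule.smul_mem _ _ (add_mem hb' hcE')⟩,
      ((0, α.2.1, α.2.2), (u' : R) • (0, β.2.1, 0)), ⟨rfl, by simp, by simp, (u' : R) • y,
        Submodule.smul_mem _ _ hy, ?_⟩, ?_⟩
    · have : e • (p₁ • α.2.1 + w₁ • (u' : R) • β.2.1 - q₁ • (u' : R) • y.2.1) = 0 := by
        rw [hw, hq, hp] at e2
        rw [smul_sub, sub_eq_zero, smul_add]
        simp only [smul_smul] at e2 ⊢
        convert e2 using 2
        · congr 1; ring
        · ring
      have := sub_eq_zero.1 (he _ this)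
      simpa using this
    · obtain ⟨α1, α2, α3⟩ := α
      obtain ⟨β1, β2, β3⟩ := β
      simp only at hc1 hc2 e4
      subst hc1 hc2 e4
      refine Prod.ext ?_ ?_ <;> ext <;> simp
  · intro h
    obtain ⟨⟨a', b'⟩, ⟨ha', hb'⟩, ⟨α, β⟩, ⟨h1, h2, h3, y, hy, h4⟩, h⟩ := Submodule.mem_sup.1 h
    have ha : a = a' + α := (congrArg Prod.fst h).symm
    have hb : (u' : R) • b = b' + β := (congrArg Prod.snd h).symm
    have hb2 : b = (↑u'⁻¹ : R) • b' + (↑u'⁻¹ : R) • β := by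
      rw [← smul_add, ← hb, smul_smul]; simp
    simp only at ha' hb' h1 h2 h3 h4
    have hy' := hY y hy
    have : p • a + w • b = p • a' + w • (↑u'⁻¹ : R) • b' + q • (↑u'⁻¹ : R) • y := by
      have h5 : p • α + w • (↑u'⁻¹ : R) • β = q • (↑u'⁻¹ : R) • y := by
        refine Prod.ext ?_ (Prod.ext ?_ ?_)
        · simp [h1, h2, hy'.1]
        · have h6 : p • α.2.1 + w • (↑u'⁻¹ : R) • β.2.1 = q • (↑u'⁻¹ : R) • y.2.1 := by
            rw [hw, hq, hp]
            have h7 := congrArg (fun x => e • x) h4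
            simp only [smul_add, smul_smul] at h7 ⊢
            have hcan : ∀ r : R, e * ↑u' * (r * ↑u'⁻¹) = e * r := by
              intro r
              calc e * ↑u' * (r * ↑u'⁻¹) = e * r * (↑u' * ↑u'⁻¹) := by ring
                _ = e * r := by simp
            rw [hcan, hcan]
            exact h7
          exact h6
        · have h6 : p • α.2.2 + w • (↑u'⁻¹ : R) • β.2.2 = q • (↑u'⁻¹ : R) • y.2.2 := by
            simp [h3, hy'.2, hpM]
          exact h6
      rw [← h5, ha, hb2]
      simp only [smul_add]
      abel
    rw [this]
    exact Submodule.add_mem_sup (Submodule.add_mem_sup ⟨a', ha', rfl⟩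
      ⟨_, Submodule.smul_mem _ _ hb', rfl⟩) ⟨_, Submodule.smul_mem _ _ hy, rfl⟩

lemma idx_W (E' YE : Submodule R (V × L × M)) (p w q p₁ w₁ q₁ e u : R)
    (hY : ∀ y ∈ YE, y.1 = 0 ∧ y.2.2 = 0)
    (hp : p = e * p₁) (hw : ∀ x : L, w • x = (e * u) • w₁ • x)
    (hq : ∀ x : L, q • x = (e * u) • q₁ • x) (he : ∀ x : L, e • x = 0 → x = 0)
    (hu : IsUnit u)
    (hV : ∀ a b : V, p • a + w • b = 0 → ∃ c, a = w • c ∧ b = - (p • c))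
    (hpM : ∀ x : M, p • x = 0) (hwM : ∀ x : M, w • x = 0 → x = 0)
    (hpE : ∀ x : V × L × M, p • x ∈ E') (hwE : ∀ x : V × L × M, w • x ∈ E') :
    idx (p • E' ⊔ w • E' ⊔ q • YE) = idx (E'.prod E' ⊔ S0 YE p₁ w₁ q₁) *
      idx (p • (⊤ : Submodule R (V × L × M)) ⊔ w • (⊤ : Submodule R (V × L × M)) ⊔ q • YE) := by
  have hWD : p • E' ⊔ w • E' ⊔ q • YE ≤
      p • (⊤ : Submodule R (V × L × M)) ⊔ w • (⊤ : Submodule R (V × L × M)) ⊔ q • YE := by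
    have h1 : ∀ r : R, r • E' ≤ r • (⊤ : Submodule R (V × L × M)) := by
      rintro r _ ⟨b, hb, rfl⟩
      exact ⟨b, trivial, rfl⟩
    exact sup_le_sup (sup_le_sup (h1 p) (h1 w)) le_rfl
  rw [idx_rel hWD (p • LinearMap.fst R (V × L × M) (V × L × M) +
    w • LinearMap.snd R (V × L × M) (V × L × M))]
  · congr 1
    rw [← idx_comap_surj (LinearMap.prodMap LinearMap.id (LinearMap.lsmul R (V × L × M) u)) ?_
      (E'.prod E' ⊔ S0 YE p₁ w₁ q₁)]
    · congr 1
      ext ⟨a, b⟩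
      exact mem_W_iff E' YE p w q p₁ w₁ q₁ e u hY hp hw hq he hu hV hpM hwM hpE hwE a b
    · obtain ⟨u', rfl⟩ := hu
      rintro ⟨a, b⟩
      refine ⟨(a, (↑u'⁻¹ : R) • b), ?_⟩
      simp [smul_smul]
  · apply le_antisymm
    · refine sup_le (sup_le ?_ ?_) ?_
      · rintro _ ⟨b, -, rfl⟩
        exact Submodule.mem_sup_right ⟨(b, 0), by simp⟩
      · rintro _ ⟨b, -, rfl⟩
        exact Submodule.mem_sup_right ⟨(0, b), by simp⟩
      · exact le_trans le_sup_right le_sup_left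
    · refine sup_le hWD ?_
      rintro _ ⟨⟨a, b⟩, rfl⟩
      refine Submodule.mem_sup_left (Submodule.add_mem_sup ⟨a, trivial, rfl⟩ ⟨b, trivial, rfl⟩)

lemma idx_D (YE : Submodule R (V × L × M)) (p w q p₁ w₁ q₁ e u : R)
    (hY : ∀ y ∈ YE, y.1 = 0 ∧ y.2.2 = 0)
    (hp : p = e * p₁) (hw : ∀ x : L, w • x = (e * u) • w₁ • x)
    (hq : ∀ x : L, q • x = (e * u) • q₁ • x) (he : ∀ x : L, e • x = 0 → x = 0)
    (hu : IsUnit u) (hpM : ∀ x : M, p • x = 0) :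
    idx (p • (⊤ : Submodule R (V × L × M)) ⊔ w • (⊤ : Submodule R (V × L × M)) ⊔ q • YE) =
     idx (p • (⊤ : Submodule R V) ⊔ w • (⊤ : Submodule R V)) *
      (idx (p₁ • (⊤ : Submodule R L) ⊔ w₁ • (⊤ : Submodule R L) ⊔
        q₁ • YE.map (LinearMap.fst R L M ∘ₗ LinearMap.snd R V (L × M))) *
        idx (e • (⊤ : Submodule R L)) * idx (w • (⊤ : Submodule R M))) := by
  rw [← idx_smul_inj e he, ← idx_prod, ← idx_prod]
  congr 1
  obtain ⟨u', rfl⟩ := hu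
  apply le_antisymm
  · refine sup_le (sup_le ?_ ?_) ?_
    · rintro _ ⟨⟨a, b, c⟩, -, rfl⟩
      refine ⟨Submodule.mem_sup_left ⟨a, trivial, rfl⟩, ⟨p₁ • b, ?_, ?_⟩, ⟨0, trivial, ?_⟩⟩
      · exact Submodule.mem_sup_left (Submodule.mem_sup_left ⟨b, trivial, rfl⟩)
      · change e • p₁ • b = p • b
        rw [hp, mul_smul]
      · simp [hpM]
    · rintro _ ⟨⟨a, b, c⟩, -, rfl⟩
      refine ⟨Submodule.mem_sup_right ⟨a, trivial, rfl⟩, ⟨w₁ • (u' : R) • b, ?_, ?_⟩, ⟨c, trivial, ?_⟩⟩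
      · exact Submodule.mem_sup_left (Submodule.mem_sup_right ⟨_, trivial, rfl⟩)
      · simp only [DistribSMul.toLinearMap_apply, Prod.smul_mk, hw, smul_smul]
        congr 1; ring
      · simp
    · rintro _ ⟨y, hy, rfl⟩
      obtain ⟨h1, h2⟩ := hY y hy
      refine ⟨?_, ⟨q₁ • (u' : R) • y.2.1, ?_, ?_⟩, ⟨0, trivial, ?_⟩⟩
      · simp [h1]
      · exact Submodule.mem_sup_right ⟨_, Submodule.smul_mem _ _ ⟨y, hy, rfl⟩, rfl⟩
      · simp only [DistribSMul.toLinearMap_apply, Prod.smul_fst, Prod.smul_snd, hq, smul_smul]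
        congr 1; ring
      · simp [h2]
  · rintro ⟨a, b, c⟩ ⟨h1, ⟨b', h2, h2'⟩, ⟨c', -, h3⟩⟩
    obtain ⟨_, ⟨a1, -, rfl⟩, _, ⟨a2, -, rfl⟩, h1⟩ := Submodule.mem_sup.1 h1
    obtain ⟨z, hz, _, ⟨_, ⟨y, hy, rfl⟩, rfl⟩, h2⟩ := Submodule.mem_sup.1 h2
    obtain ⟨_, ⟨b1, -, rfl⟩, _, ⟨b2, -, rfl⟩, rfl⟩ := Submodule.mem_sup.1 hz
    have hy' := hY y hy
    refine Submodule.mem_sup.2 ⟨_, Submodule.add_mem_sup ⟨(a1, b1, 0), trivial, rfl⟩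
      ⟨(a2, (↑u'⁻¹ : R) • b2, c'), trivial, rfl⟩, _, ⟨(↑u'⁻¹ : R) • y, Submodule.smul_mem _ _ hy, rfl⟩, ?_⟩
    have hcan : ∀ (r : R) (x : L), (e * ↑u') • r • (↑u'⁻¹ : R) • x = e • r • x := by
      intro r x
      simp only [smul_smul]
      congr 1
      calc e * ↑u' * (r * ↑u'⁻¹) = e * r * (↑u' * ↑u'⁻¹) := by ring
                  _ = e * r := by simp
    simp only [DistribSMul.toLinearMap_apply, LinearMap.comp_apply, LinearMap.fst_apply,
      LinearMap.snd_apply] at h1 h2 h2' h3 ⊢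
    refine Prod.ext ?_ (Prod.ext ?_ ?_)
    · simpa [hy'.1] using h1
    · have : p • b1 + w • (↑u'⁻¹ : R) • b2 + q • (↑u'⁻¹ : R) • y.2.1 = b := by
        rw [hw, hq, hcan, hcan, ← h2', ← h2, hp, mul_smul, smul_add, smul_add]
      exact this
    · simpa [hy'.2] using h3

end Abs

section Main

variable (ℓ : ℕ) [hℓ : Fact ℓ.Prime]

lemma idx_V (ρ n k : ℕ) :
    idx ((ℓ : Lam ℓ) ^ k • (⊤ : Submodule (Lam ℓ) (Fin ρ → Lam ℓ)) ⊔
      omegaIw ℓ n • (⊤ : Submodule (Lam ℓ) (Fin ρ → Lam ℓ))) = ℓ ^ (ρ * k * ℓ ^ n) := by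
  have : (ℓ : Lam ℓ) ^ k • (⊤ : Submodule (Lam ℓ) (Fin ρ → Lam ℓ)) ⊔
      omegaIw ℓ n • (⊤ : Submodule (Lam ℓ) (Fin ρ → Lam ℓ)) =
      Submodule.pi Set.univ (fun _ : Fin ρ => (ℓ : Lam ℓ) ^ k • (⊤ : Submodule (Lam ℓ) (Lam ℓ)) ⊔
      omegaIw ℓ n • (⊤ : Submodule (Lam ℓ) (Lam ℓ))) := by
    apply le_antisymm
    · refine sup_le ?_ ?_
      · rintro _ ⟨b, -, rfl⟩ i -
        exact Submodule.mem_sup_left ⟨b i, trivial, rfl⟩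
      · rintro _ ⟨b, -, rfl⟩ i -
        exact Submodule.mem_sup_right ⟨b i, trivial, rfl⟩
    · intro x hx
      have : ∀ i, ∃ a b : Lam ℓ, (ℓ : Lam ℓ) ^ k • a + omegaIw ℓ n • b = x i := by
        intro i
        obtain ⟨_, ⟨a, -, rfl⟩, _, ⟨b, -, rfl⟩, h⟩ := Submodule.mem_sup.1 (hx i trivial)
        exact ⟨a, b, h⟩
      choose a b h using this
      refine Submodule.mem_sup.2 ⟨_, ⟨a, trivial, rfl⟩, _, ⟨b, trivial, rfl⟩, funext h⟩
  rw [this, idx_pi_smul]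
  simp only [idx_nabla, Finset.prod_const, Finset.card_univ, Fintype.card_fin]
  rw [← pow_mul]; congr 1; ring

lemma idx_L {ι : Type} [Fintype ι] (f : ι → Polynomial ℤ_[ℓ])
    (hf : ∀ i, IsDistinguishedAt ℓ (f i)) (k : ℕ) :
    idx ((ℓ : Lam ℓ) ^ k •
      (⊤ : Submodule (Lam ℓ) ((i : ι) → Lam ℓ ⧸ Ideal.span {((f i : Lam ℓ))}))) =
      ℓ ^ (k * ∑ i, (f i).natDegree) := by
  rw [smul_top_pi, idx_pi_smul, Finset.mul_sum, ← Finset.prod_pow_eq_pow_sum]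
  exact Finset.prod_congr rfl fun i _ => idx_quot_ell ℓ _ (hf i) k

lemma idx_M {κ : Type} [Fintype κ] (m : κ → ℕ) (n : ℕ) :
    idx (omegaIw ℓ n •
      (⊤ : Submodule (Lam ℓ) ((j : κ) → Lam ℓ ⧸ Ideal.span {(ℓ : Lam ℓ) ^ (m j)}))) =
      ℓ ^ ((∑ j, m j) * ℓ ^ n) := by
  rw [smul_top_pi, idx_pi_smul, Finset.sum_mul, ← Finset.prod_pow_eq_pow_sum]
  exact Finset.prod_congr rfl fun i _ => idx_mu ℓ _ n

lemma smul_quot_eq_zero (a r : Lam ℓ) (h : a ∣ r) (x : Lam ℓ ⧸ Ideal.span {a}) : r • x = 0 := by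
  obtain ⟨x, rfl⟩ := Submodule.mkQ_surjective _ x
  rw [← map_smul]
  refine (Submodule.Quotient.mk_eq_zero _).2 ?_
  rw [Ideal.mem_span_singleton]
  exact h.mul_right x

lemma ell_pow_inj (g : Polynomial ℤ_[ℓ]) (hg : IsDistinguishedAt ℓ g) (j : ℕ)
    (x : Lam ℓ ⧸ Ideal.span {(g : Lam ℓ)}) (hx : (ℓ : Lam ℓ) ^ j • x = 0) : x = 0 := by
  induction j with
  | zero => simpa using hx
  | succ j ih =>
    refine ih (ell_inj_quot ℓ g hg _ ?_)
    rw [smul_smul, ← pow_succ']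
    exact hx

lemma elem_main (ρ : ℕ) {ι κ : Type} [Fintype ι] [Fintype κ]
    (f : ι → Polynomial ℤ_[ℓ]) (hf : ∀ i, IsDistinguishedAt ℓ (f i)) (m : κ → ℕ)
    (E' YE : Submodule (Lam ℓ) (ElemMod ℓ ρ f m)) (hE' : Finite (ElemMod ℓ ρ f m ⧸ E'))
    (hY : ∀ y ∈ YE, y.1 = 0 ∧ y.2.2 = 0) (m' : ℕ) :
    ∃ C ≠ 0, ∃ n₁ ≥ m', ∀ j, ∀ q : Lam ℓ, omegaIw ℓ (n₁ + j) = omegaIw ℓ m' * q →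
      idx ((ℓ : Lam ℓ) ^ (n₁ + j + 1) • E' ⊔ omegaIw ℓ (n₁ + j) • E' ⊔ q • YE) =
      C * ℓ ^ (ρ * (n₁ + j + 1) * ℓ ^ (n₁ + j) + (∑ i, m i) * ℓ ^ (n₁ + j) +
        j * ∑ i, (f i).natDegree) := by
  obtain ⟨k₁, hk₁⟩ := exists_Theta ℓ (∏ i, f i) (dist_prod ℓ f hf)
  obtain ⟨k₂, hk₂⟩ := finite_killed ℓ (N := ElemMod ℓ ρ f m ⧸ E')
  set n₁ := m' + k₁ + k₂ + ∑ j, m j with hn₁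
  obtain ⟨q₁, hq₁⟩ : ∃ q₁, omegaIw ℓ n₁ = omegaIw ℓ m' * q₁ := by
    rw [hn₁, add_assoc, add_assoc]; exact omega_dvd ℓ _ _
  have hEi : idx E' ≠ 0 := AddSubgroup.index_ne_zero_of_finite (hH := hE')
  have hℓ0 : ∀ k, ℓ ^ k ≠ 0 := fun k => pow_ne_zero _ hℓ.out.ne_zero
  refine ⟨idx (E'.prod E' ⊔ S0 YE ((ℓ : Lam ℓ) ^ (n₁ + 1)) (omegaIw ℓ n₁) q₁) *
    idx (((ℓ : Lam ℓ) ^ (n₁ + 1)) • (⊤ : Submodule (Lam ℓ) ((i : ι) → Lam ℓ ⧸ Ideal.span {((f i : Lam ℓ))}))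
      ⊔ omegaIw ℓ n₁ • (⊤ : Submodule (Lam ℓ) ((i : ι) → Lam ℓ ⧸ Ideal.span {((f i : Lam ℓ))})) ⊔
        q₁ • YE.map (LinearMap.fst (Lam ℓ) _ _ ∘ₗ LinearMap.snd (Lam ℓ) _ _)), ?_, n₁, by omega, ?_⟩
  · refine mul_ne_zero ?_ ?_
    · refine idx_ne_zero_of_le le_sup_left ?_
      rw [idx_prod]
      exact mul_ne_zero hEi hEi
    · refine idx_ne_zero_of_le (le_trans le_sup_left le_sup_left) ?_
      rw [idx_L ℓ f hf]
      exact hℓ0 _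
  · intro j q hq
    obtain ⟨Θ, u, hu, hΘ, hF⟩ := hk₁ n₁ (by omega) j
    have hqΘ : q = q₁ * Θ := by
      refine mul_left_cancel₀ (omega_ne_zero ℓ m') ?_
      rw [← hq, hΘ, hq₁, mul_assoc]
    have hΘL : ∀ x : (i : ι) → Lam ℓ ⧸ Ideal.span {((f i : Lam ℓ))},
        Θ • x = ((ℓ : Lam ℓ) ^ j * u) • x := by
      intro x
      funext i
      have h1 : f i ∣ ∏ i, f i := Finset.dvd_prod_of_mem f (Finset.mem_univ i)
      have h2 : (f i : Lam ℓ) ∣ ((∏ i, f i : Polynomial ℤ_[ℓ]) : Lam ℓ) :=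
        map_dvd (Polynomial.coeToPowerSeries.ringHom) h1
      have h3 := smul_quot_eq_zero ℓ _ _ (dvd_trans h2 hF) (x i)
      rw [sub_smul, sub_eq_zero] at h3
      exact h3
    have hp : (ℓ : Lam ℓ) ^ (n₁ + j + 1) = ℓ ^ j * ℓ ^ (n₁ + 1) := by ring
    have hw : ∀ x : (i : ι) → Lam ℓ ⧸ Ideal.span {((f i : Lam ℓ))},
        omegaIw ℓ (n₁ + j) • x = ((ℓ : Lam ℓ) ^ j * u) • omegaIw ℓ n₁ • x := by
      intro x
      rw [← hΘL, hΘ, smul_smul, mul_comm]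
    have hq : ∀ x : (i : ι) → Lam ℓ ⧸ Ideal.span {((f i : Lam ℓ))},
        q • x = ((ℓ : Lam ℓ) ^ j * u) • q₁ • x := by
      intro x
      rw [← hΘL, hqΘ, smul_smul, mul_comm]
    have he : ∀ x : (i : ι) → Lam ℓ ⧸ Ideal.span {((f i : Lam ℓ))},
        (ℓ : Lam ℓ) ^ j • x = 0 → x = 0 := by
      intro x hx
      funext i
      exact ell_pow_inj ℓ _ (hf i) j _ (congrFun hx i)
    have hV : ∀ a b : Fin ρ → Lam ℓ, (ℓ : Lam ℓ) ^ (n₁ + j + 1) • a + omegaIw ℓ (n₁ + j) • b = 0 →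
        ∃ c, a = omegaIw ℓ (n₁ + j) • c ∧ b = - ((ℓ : Lam ℓ) ^ (n₁ + j + 1) • c) := by
      intro a b h
      choose c h1 h2 using fun i => omega_ell_coprime ℓ _ _ (a i) (b i) (congrFun h i)
      exact ⟨c, funext h1, funext h2⟩
    have hpM : ∀ x : (j : κ) → Lam ℓ ⧸ Ideal.span {(ℓ : Lam ℓ) ^ (m j)},
        (ℓ : Lam ℓ) ^ (n₁ + j + 1) • x = 0 := by
      intro x
      funext i
      refine smul_quot_eq_zero ℓ _ _ (pow_dvd_pow _ ?_) _
      have := Finset.single_le_sum (f := m) (fun _ _ => Nat.zero_le _) (Finset.mem_univ i)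
      omega
    have hwM : ∀ x : (j : κ) → Lam ℓ ⧸ Ideal.span {(ℓ : Lam ℓ) ^ (m j)},
        omegaIw ℓ (n₁ + j) • x = 0 → x = 0 := by
      intro x hx
      funext i
      exact quot_ell_inj ℓ _ _ (omega_not_dvd ℓ _) _ (congrFun hx i)
    have hkill : ∀ r ∈ mm ℓ ^ k₂, ∀ x : ElemMod ℓ ρ f m, r • x ∈ E' := by
      intro r hr x
      have := hk₂ r hr (E'.mkQ x)
      rw [← map_smul] at this
      exact (Submodule.Quotient.mk_eq_zero _).1 this
    have hpE := hkill ((ℓ : Lam ℓ) ^ (n₁ + j + 1))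
      (Ideal.pow_le_pow_right (by omega) (Ideal.pow_mem_pow (ell_mem ℓ) _))
    have hwE := hkill (omegaIw ℓ (n₁ + j))
      (Ideal.pow_le_pow_right (by omega) (omega_mem ℓ _))
    rw [idx_W E' YE _ _ q _ _ q₁ _ u hY hp hw hq he hu hV hpM hwM hpE hwE,
      idx_D YE _ _ q _ _ q₁ _ u hY hp hw hq he hu hpM, idx_V, idx_L ℓ f hf, idx_M]
    rw [pow_add, pow_add]
    ring

lemma stabilize (r : ℕ → ℕ) (hr : Monotone r) (B : ℕ) (hB : ∀ n, r n ≤ B) :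
    ∃ N, ∀ n ≥ N, r n = r N := by
  refine ⟨Function.argmin (fun n => B - r n), fun n hn => ?_⟩
  have h1 := Function.argmin_le (fun n => B - r n) n
  have h2 := hr hn
  have h3 := hB n
  have h4 := hB (Function.argmin (fun n => B - r n))
  omega

lemma card_pow {G : Type*} [AddCommGroup G] [Finite G] (k : ℕ) (h : ∀ x : G, ℓ ^ k • x = 0) :
    ∃ a, Nat.card G = ℓ ^ a := by
  have : IsPGroup ℓ (Multiplicative G) := fun g => ⟨k, h g.toAdd⟩
  exact (IsPGroup.iff_card (G := Multiplicative G)).1 this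

/-- the submodule at level `n`, in pointwise form -/
noncomputable def ZZ {X : Type} [AddCommGroup X] [Module (Lam ℓ) X] (Y : Submodule (Lam ℓ) X)
    (n : ℕ) (q : Lam ℓ) : Submodule (Lam ℓ) X :=
  (ℓ : Lam ℓ) ^ (n + 1) • (⊤ : Submodule (Lam ℓ) X) ⊔ omegaIw ℓ n • (⊤ : Submodule (Lam ℓ) X) ⊔ q • Y

lemma ZZ_eq {X : Type} [AddCommGroup X] [Module (Lam ℓ) X] (Y : Submodule (Lam ℓ) X)
    (n : ℕ) (q : Lam ℓ) :
    nablaN ℓ n (⊤ : Submodule (Lam ℓ) X) ⊔ Ideal.span {q} • Y = ZZ ℓ Y n q := by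
  rw [nablaN, Submodule.ideal_span_singleton_smul, Submodule.ideal_span_singleton_smul,
    Submodule.ideal_span_singleton_smul, ZZ]

lemma mul_smul_le' {X : Type} [AddCommGroup X] [Module (Lam ℓ) X] (Y : Submodule (Lam ℓ) X)
    (r s : Lam ℓ) : (r * s) • Y ≤ r • Y := by
  rintro _ ⟨y, hy, rfl⟩
  exact ⟨s • y, Submodule.smul_mem _ _ hy, by
    change r • s • y = (r * s) • y
    rw [mul_smul]⟩

lemma ZZ_succ {X : Type} [AddCommGroup X] [Module (Lam ℓ) X] (Y : Submodule (Lam ℓ) X)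
    (n : ℕ) (q : Lam ℓ) : ZZ ℓ Y (n + 1) (q * theta ℓ n) ≤ ZZ ℓ Y n q := by
  rw [ZZ, ZZ, omega_succ, pow_succ _ (n + 1)]
  exact sup_le_sup (sup_le_sup (mul_smul_le' ℓ _ _ _) (mul_smul_le' ℓ _ _ _)) (mul_smul_le' ℓ _ _ _)

/-- iterated quotient -/
noncomputable def qq (m' : ℕ) : ℕ → Lam ℓ
  | 0 => 1
  | j + 1 => qq m' j * theta ℓ (m' + j)

lemma qq_spec (m' j : ℕ) : omegaIw ℓ (m' + j) = omegaIw ℓ m' * qq ℓ m' j := by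
  induction j with
  | zero => simp [qq]
  | succ j ih => rw [← add_assoc, omega_succ, ih, qq, mul_assoc]

lemma final (ρ : ℕ) {ι κ : Type} [Fintype ι] [Fintype κ]
    (f : ι → Polynomial ℤ_[ℓ]) (hf : ∀ i, IsDistinguishedAt ℓ (f i)) (m : κ → ℕ)
    (X : Type) [AddCommGroup X] [Module (Lam ℓ) X]
    (t : X →ₗ[Lam ℓ] ElemMod ℓ ρ f m)
    (hker : Finite (LinearMap.ker t))
    (hcoker : Finite (ElemMod ℓ ρ f m ⧸ LinearMap.range t))
    (Y : Submodule (Lam ℓ) X)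
    (hY : ∀ y ∈ Y.map t, y.1 = 0 ∧ y.2.2 = 0) (m' : ℕ) :
    ∃ K ≠ 0, ∃ C ≠ 0, ∃ n₀ ≥ m', ∀ n ≥ n₀, ∀ q : Lam ℓ, omegaIw ℓ n = omegaIw ℓ m' * q →
      idx (ZZ ℓ Y n q) * K = C * ℓ ^ (ρ * (n + 1) * ℓ ^ n + (∑ i, m i) * ℓ ^ n +
        (∑ i, (f i).natDegree) * n) := by
  obtain ⟨C, hC, n₁, hn₁, H⟩ := elem_main ℓ ρ f hf m (LinearMap.range t) (Y.map t) hcoker hY m'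
  let r : ℕ → ℕ := fun j => (ZZ ℓ Y (m' + j) (qq ℓ m' j)).toAddSubgroup.relIndex
    (LinearMap.ker t).toAddSubgroup
  have hker' : Finite (LinearMap.ker t).toAddSubgroup := hker
  have hr0 : ∀ j, r j ≠ 0 := fun j =>
    ne_zero_of_dvd_ne_zero (Nat.card_pos (α := (LinearMap.ker t).toAddSubgroup)).ne'
      (AddSubgroup.relIndex_dvd_card _ _)
  have hrm : Monotone r := by
    refine monotone_nat_of_le_succ fun j => ?_
    refine Nat.le_of_dvd (Nat.pos_of_ne_zero (hr0 _)) ?_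
    exact AddSubgroup.relIndex_dvd_of_le_left _ (ZZ_succ ℓ Y (m' + j) (qq ℓ m' j))
  obtain ⟨N, hN⟩ := stabilize r hrm (Nat.card (LinearMap.ker t).toAddSubgroup) (fun j =>
    Nat.le_of_dvd (Nat.card_pos (α := (LinearMap.ker t).toAddSubgroup))
      (AddSubgroup.relIndex_dvd_card _ _))
  have hT : idx (LinearMap.range t) ≠ 0 := AddSubgroup.index_ne_zero_of_finite (hH := hcoker)
  refine ⟨idx (LinearMap.range t) * ℓ ^ ((∑ i, (f i).natDegree) * n₁),
    mul_ne_zero hT (pow_ne_zero _ hℓ.out.ne_zero), r N * C, mul_ne_zero (hr0 N) hC,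
    n₁ + N, by omega, ?_⟩
  intro n hn q hq
  obtain ⟨j, rfl⟩ : ∃ j, n = n₁ + j := ⟨n - n₁, by omega⟩
  have h1 := H j q hq
  obtain ⟨i, hi⟩ : ∃ i, n₁ + j = m' + i := ⟨n₁ + j - m', by omega⟩
  have hqi : q = qq ℓ m' i := by
    refine mul_left_cancel₀ (omega_ne_zero ℓ m') ?_
    rw [← hq, hi, qq_spec]
  have hri : (ZZ ℓ Y (n₁ + j) q).toAddSubgroup.relIndex (LinearMap.ker t).toAddSubgroup = r N := by
    rw [← hN i (by omega), hi, hqi]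
  have hmap : (ZZ ℓ Y (n₁ + j) q).map t = (ℓ : Lam ℓ) ^ (n₁ + j + 1) • LinearMap.range t ⊔
      omegaIw ℓ (n₁ + j) • LinearMap.range t ⊔ q • Y.map t := by
    rw [ZZ, Submodule.map_sup, Submodule.map_sup, Submodule.map_pointwise_smul,
      Submodule.map_pointwise_smul, Submodule.map_pointwise_smul, Submodule.map_top]
  rw [← hmap] at h1
  have h2 : idx ((ZZ ℓ Y (n₁ + j) q).map t) =
      idx (ZZ ℓ Y (n₁ + j) q ⊔ LinearMap.ker t) * idx (LinearMap.range t) := by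
    have := AddSubgroup.index_map (ZZ ℓ Y (n₁ + j) q).toAddSubgroup t.toAddMonoidHom
    rw [idx, idx, idx, Submodule.sup_toAddSubgroup]
    exact this
  have h3 : idx (ZZ ℓ Y (n₁ + j) q) = r N * idx (ZZ ℓ Y (n₁ + j) q ⊔ LinearMap.ker t) := by
    rw [← hri, ← AddSubgroup.relIndex_sup_left, idx, idx, Submodule.sup_toAddSubgroup]
    exact (AddSubgroup.relIndex_mul_index le_sup_left).symm
  rw [h3]
  calc _ = r N * idx ((ZZ ℓ Y (n₁ + j) q).map t) * ℓ ^ ((∑ i, (f i).natDegree) * n₁) := by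
        rw [h2]; ring
    _ = _ := by
        have hexp : ρ * (n₁ + j + 1) * ℓ ^ (n₁ + j) + (∑ i, m i) * ℓ ^ (n₁ + j) +
            (∑ i, (f i).natDegree) * (n₁ + j) =
          (ρ * (n₁ + j + 1) * ℓ ^ (n₁ + j) + (∑ i, m i) * ℓ ^ (n₁ + j) +
            j * ∑ i, (f i).natDegree) + (∑ i, (f i).natDegree) * n₁ := by ring
        rw [h1, hexp, pow_add ℓ (_ + j * _)]
        simp only [mul_assoc]

end Main
end IwAux

/-- Let `X` be a finitely generated `Λ`-module with Iwasawa invariants `ρ, μ, λ` (given by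
a pseudo-isomorphism onto an elementary module), and `Y ⊆ X` a `Λ`-submodule finitely
generated over `ℤ_ℓ`. Then for every sufficiently large fixed `m`, the quotients
`Y_n = X/(∇_nX + (ω_n/ω_m)Y)` are finite for `n ≥ m` of orders `ℓ^(y_n)` with
`y_n = ρ(n+1)ℓ^n + μℓ^n + λn + ν` eventually. -/
theorem parameters_theorem_with_submodule (ℓ : ℕ) [Fact ℓ.Prime]
    (ρ : ℕ) (ι κ : Type) [Fintype ι] [Fintype κ]
    (f : ι → Polynomial ℤ_[ℓ]) (hf : ∀ i, IsDistinguishedAt ℓ (f i))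
    (m : κ → ℕ) (hm : ∀ j, 0 < m j)
    (X : Type) [AddCommGroup X] [Module (Lam ℓ) X] [Module.Finite (Lam ℓ) X]
    [Module ℤ_[ℓ] X] [IsScalarTower ℤ_[ℓ] (Lam ℓ) X]
    (t : X →ₗ[Lam ℓ] ElemMod ℓ ρ f m)
    (hker : Finite (LinearMap.ker t))
    (hcoker : Finite (ElemMod ℓ ρ f m ⧸ LinearMap.range t))
    (Y : Submodule (Lam ℓ) X) (hY : Module.Finite ℤ_[ℓ] Y) :
    ∃ m₀ : ℕ, ∀ m' ≥ m₀, ∃ (ν : ℤ) (n₀ : ℕ), n₀ ≥ m' ∧ ∀ n ≥ n₀, ∀ q : Lam ℓ,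
      omegaIw ℓ n = omegaIw ℓ m' * q →
      Finite (X ⧸ (nablaN ℓ n (⊤ : Submodule (Lam ℓ) X) ⊔ Ideal.span {q} • Y)) ∧
      (Nat.card (X ⧸ (nablaN ℓ n (⊤ : Submodule (Lam ℓ) X) ⊔ Ideal.span {q} • Y)) : ℚ) =
        (ℓ : ℚ) ^ (((ρ * (n + 1) * ℓ ^ n + (∑ j, m j) * ℓ ^ n +
          (∑ i, (f i).natDegree) * n : ℕ) : ℤ) + ν) := by
  obtain ⟨p, hpm, hp⟩ := IwAux.exists_killer ℓ (Y := Y)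
  have hYE : ∀ y ∈ Y.map t, y.1 = 0 ∧ y.2.2 = 0 := by
    rintro _ ⟨y, hy, rfl⟩
    have h0 : (p : Lam ℓ) • t y = 0 := by
      have h1 : (p : Lam ℓ) • y = 0 := congrArg Subtype.val (hp ⟨y, hy⟩)
      rw [← map_smul, h1, map_zero]
    have hnd := IwAux.monic_not_dvd ℓ p hpm
    have hne : (p : Lam ℓ) ≠ 0 := fun h => hnd (h ▸ dvd_zero _)
    constructor
    · funext i
      have h2 : (p : Lam ℓ) * (t y).1 i = 0 := congrFun (congrArg Prod.fst h0) i
      exact (mul_eq_zero.1 h2).resolve_left hne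
    · funext j
      exact IwAux.quot_ell_inj ℓ _ _ hnd _ (congrFun (congrArg (fun z => z.2.2) h0) j)
  refine ⟨0, fun m' _ => ?_⟩
  obtain ⟨K, hK, C, hC, n₀, hn₀, H⟩ := IwAux.final ℓ ρ f hf m X t hker hcoker Y hYE m'
  have hℓ0 : (ℓ : ℕ) ≠ 0 := (Fact.out : ℓ.Prime).ne_zero
  have hℓQ : (ℓ : ℚ) ≠ 0 := by exact_mod_cast hℓ0
  have hKQ : (K : ℚ) ≠ 0 := by exact_mod_cast hK
  have hfin : ∀ n ≥ n₀, ∀ q : Lam ℓ, omegaIw ℓ n = omegaIw ℓ m' * q →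
      IwAux.idx (IwAux.ZZ ℓ Y n q) ≠ 0 := by
    intro n hn q hq h0
    have := H n hn q hq
    rw [h0, zero_mul] at this
    exact mul_ne_zero hC (pow_ne_zero _ hℓ0) this.symm
  obtain ⟨q₀, hq₀⟩ : ∃ q, omegaIw ℓ n₀ = omegaIw ℓ m' * q := by
    obtain ⟨j, rfl⟩ : ∃ j, n₀ = m' + j := ⟨n₀ - m', by omega⟩
    exact IwAux.omega_dvd ℓ _ _
  obtain ⟨a, ha⟩ : ∃ a, IwAux.idx (IwAux.ZZ ℓ Y n₀ q₀) = ℓ ^ a := by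
    haveI : Finite (X ⧸ IwAux.ZZ ℓ Y n₀ q₀) :=
      AddSubgroup.index_ne_zero_iff_finite.1 (hfin n₀ le_rfl q₀ hq₀)
    refine IwAux.card_pow ℓ (G := X ⧸ IwAux.ZZ ℓ Y n₀ q₀) (n₀ + 1) ?_
    intro x
    obtain ⟨x, rfl⟩ := Submodule.mkQ_surjective _ x
    rw [← map_nsmul]
    refine (Submodule.Quotient.mk_eq_zero _).2 ?_
    refine Submodule.mem_sup_left (Submodule.mem_sup_left ⟨x, trivial, ?_⟩)
    change (ℓ : Lam ℓ) ^ (n₀ + 1) • x = _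
    rw [← Nat.cast_pow, Nat.cast_smul_eq_nsmul]
  have h0 := H n₀ le_rfl q₀ hq₀
  rw [ha] at h0
  refine ⟨(a : ℤ) - ((ρ * (n₀ + 1) * ℓ ^ n₀ + (∑ j, m j) * ℓ ^ n₀ +
          (∑ i, (f i).natDegree) * n₀ : ℕ) : ℤ), n₀, hn₀, ?_⟩
  intro n hn q hq
  rw [IwAux.ZZ_eq]
  have h1 := H n hn q hq
  refine ⟨AddSubgroup.index_ne_zero_iff_finite.1 (hfin n hn q hq), ?_⟩
  change ((IwAux.idx (IwAux.ZZ ℓ Y n q) : ℕ) : ℚ) = _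
  generalize (ρ * (n + 1) * ℓ ^ n + (∑ j, m j) * ℓ ^ n + (∑ i, (f i).natDegree) * n : ℕ) = A at *
  generalize (ρ * (n₀ + 1) * ℓ ^ n₀ + (∑ j, m j) * ℓ ^ n₀ +
    (∑ i, (f i).natDegree) * n₀ : ℕ) = A₀ at *
  rw [zpow_add₀ hℓQ, zpow_sub₀ hℓQ, zpow_natCast, zpow_natCast, zpow_natCast]
  have h0' : (ℓ : ℚ) ^ a * K = C * ℓ ^ A₀ := by exact_mod_cast h0
  have h1' : (IwAux.idx (IwAux.ZZ ℓ Y n q) : ℚ) * K = C * ℓ ^ A := by exact_mod_cast h1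
  have hA₀ : (ℓ : ℚ) ^ A₀ ≠ 0 := pow_ne_zero _ hℓQ
  rw [mul_div_assoc', eq_div_iff hA₀]
  refine mul_right_cancel₀ hKQ ?_
  linear_combination (ℓ : ℚ) ^ A₀ * h1' - (ℓ : ℚ) ^ A * h0'
end

section
/- Let X be a finitely generated Λ-module (Λ = ℤ_ℓ[[T]]) with Iwasawa invariants ρ, μ, λ, and fix an integer k ≥ 1. Define ∇_{n,k} = ℓ^{n+k}Λ + ω_nΛ with ω_n = (1+T)^{ℓ^n} − 1. Then there exist an integer ν and n_0 such that for all n ≥ n_0 the quotient X/∇_{n,k}X is finite of order ℓ^{x_n} with x_n = ρ(n+k)ℓ^n + μℓ^n + λn + ν; equivalently, the sequence (X/∇_{n,k}X) is parametrized by the invariants ρ, μ + (k−1)ρ, λ. -/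
/-- `∇_{n,k}N = ℓ^(n+k)N + ω_nN` for a submodule `N` of a `Λ`-module. -/
noncomputable def nablaNK (ℓ : ℕ) [Fact ℓ.Prime] {M : Type*} [AddCommGroup M]
    [Module (Lam ℓ) M] (n k : ℕ) (N : Submodule (Lam ℓ) M) : Submodule (Lam ℓ) M :=
  (Ideal.span {(ℓ : Lam ℓ) ^ (n + k)}) • N ⊔ (Ideal.span {omegaIw ℓ n}) • N


section Aux
variable {ℓ : ℕ} [Fact ℓ.Prime]

theorem mem_nablaNK {M : Type*} [AddCommGroup M] [Module (Lam ℓ) M] (n k : ℕ)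
    (N : Submodule (Lam ℓ) M) (x : M) :
    x ∈ nablaNK ℓ n k N ↔
      ∃ a ∈ N, ∃ b ∈ N, ((ℓ : Lam ℓ) ^ (n + k)) • a + omegaIw ℓ n • b = x := by
  unfold nablaNK
  rw [Submodule.ideal_span_singleton_smul, Submodule.ideal_span_singleton_smul, Submodule.mem_sup]
  constructor
  · rintro ⟨y, hy, z, hz, rfl⟩
    rw [Submodule.mem_smul_pointwise_iff_exists] at hy hz
    obtain ⟨a, ha, rfl⟩ := hy
    obtain ⟨b, hb, rfl⟩ := hz
    exact ⟨a, ha, b, hb, rfl⟩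
  · rintro ⟨a, ha, b, hb, rfl⟩
    exact ⟨_, Submodule.smul_mem_pointwise_smul _ _ _ ha, _,
      Submodule.smul_mem_pointwise_smul _ _ _ hb, rfl⟩

theorem omega_succ (n : ℕ) :
    ∃ h, omegaIw ℓ (n + 1) = omegaIw ℓ n * ((ℓ : Lam ℓ) + omegaIw ℓ n * h) := by
  obtain ⟨h, hh⟩ := Polynomial.powAddExpansion 1 (omegaIw ℓ n) ℓ
  refine ⟨h, ?_⟩
  have e : (1 + omegaIw ℓ n) = (1 + PowerSeries.X) ^ (ℓ ^ n) := by
    unfold omegaIw; ring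
  have : omegaIw ℓ (n + 1) = (1 + omegaIw ℓ n) ^ ℓ - 1 := by
    rw [e, ← pow_mul, ← pow_succ]; rfl
  rw [this, hh]; simp; ring

theorem omega_dvd {n n' : ℕ} (h : n ≤ n') : omegaIw ℓ n ∣ omegaIw ℓ n' := by
  induction n', h using Nat.le_induction with
  | base => exact dvd_rfl
  | succ j _ ih =>
    obtain ⟨h, hh⟩ := omega_succ (ℓ := ℓ) j
    exact ih.trans ⟨_, hh⟩

theorem nabla_anti {M : Type*} [AddCommGroup M] [Module (Lam ℓ) M] {n n' k k' : ℕ}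
    (h : n ≤ n') (h' : n + k ≤ n' + k') (N : Submodule (Lam ℓ) M) :
    nablaNK ℓ n' k' N ≤ nablaNK ℓ n k N := by
  intro x hx
  rw [mem_nablaNK] at hx ⊢
  obtain ⟨a, ha, b, hb, rfl⟩ := hx
  obtain ⟨c, hc⟩ := omega_dvd (ℓ := ℓ) h
  obtain ⟨d, hd⟩ := pow_dvd_pow (ℓ : Lam ℓ) h'
  exact ⟨d • a, N.smul_mem _ ha, c • b, N.smul_mem _ hb, by rw [hc, hd, mul_smul, mul_smul]⟩

theorem l_mem_max : (ℓ : Lam ℓ) ∈ IsLocalRing.maximalIdeal (Lam ℓ) := by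
  rw [IsLocalRing.mem_maximalIdeal, mem_nonunits_iff, PowerSeries.isUnit_iff_constantCoeff]
  simpa using (PadicInt.prime_p (p := ℓ)).not_isUnit

theorem omega_mem_max (n : ℕ) : omegaIw ℓ n ∈ (IsLocalRing.maximalIdeal (Lam ℓ)) ^ (n + 1) := by
  induction n with
  | zero =>
    rw [zero_add, pow_one, IsLocalRing.mem_maximalIdeal, mem_nonunits_iff,
      PowerSeries.isUnit_iff_constantCoeff]
    simp [omegaIw]
  | succ n ih =>
    obtain ⟨h, hh⟩ := omega_succ (ℓ := ℓ) n
    rw [hh, pow_succ]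
    refine Ideal.mul_mem_mul ih (Ideal.add_mem _ l_mem_max (Ideal.mul_mem_right _ _ ?_))
    exact Ideal.pow_le_self (by omega) ih

/-- powers of the maximal ideal kill a finite module -/
theorem exists_pow_smul_eq_bot (F : Type*) [AddCommGroup F] [Module (Lam ℓ) F] [Finite F] :
    ∃ c, (IsLocalRing.maximalIdeal (Lam ℓ)) ^ c • (⊤ : Submodule (Lam ℓ) F) = ⊥ := by
  have : IsArtinian (Lam ℓ) F := inferInstance
  let g : ℕ →o (Submodule (Lam ℓ) F)ᵒᵈ :=
    ⟨fun c => OrderDual.toDual ((IsLocalRing.maximalIdeal (Lam ℓ)) ^ c • (⊤ : Submodule (Lam ℓ) F)),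
      fun a b hab => Submodule.smul_mono_left (Ideal.pow_le_pow_right hab)⟩
  obtain ⟨c, hc⟩ := IsArtinian.monotone_stabilizes g
  refine ⟨c, ?_⟩
  have h1 := hc (c + 1) (by omega)
  have h2 : (IsLocalRing.maximalIdeal (Lam ℓ)) ^ c • (⊤ : Submodule (Lam ℓ) F) =
    (IsLocalRing.maximalIdeal (Lam ℓ)) ^ (c + 1) • (⊤ : Submodule (Lam ℓ) F) := h1
  refine Submodule.eq_bot_of_le_smul_of_le_jacobson_bot (IsLocalRing.maximalIdeal (Lam ℓ)) _
    (IsNoetherian.noetherian _) ?_ (IsLocalRing.maximalIdeal_le_jacobson _)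
  rw [pow_succ', Submodule.mul_smul] at h2
  exact h2.le

theorem nabla_le_of_finite {E : Type*} [AddCommGroup E] [Module (Lam ℓ) E]
    (Y : Submodule (Lam ℓ) E) [Finite (E ⧸ Y)] :
    ∃ c, nablaNK ℓ c 0 (⊤ : Submodule (Lam ℓ) E) ≤ Y := by
  obtain ⟨c, hc⟩ := exists_pow_smul_eq_bot (ℓ := ℓ) (E ⧸ Y)
  have key : ∀ r ∈ (IsLocalRing.maximalIdeal (Lam ℓ)) ^ c, ∀ x : E, r • x ∈ Y := by
    intro r hr x
    rw [← Submodule.Quotient.mk_eq_zero, Submodule.Quotient.mk_smul]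
    have : r • (Submodule.Quotient.mk x : E ⧸ Y) ∈
      (IsLocalRing.maximalIdeal (Lam ℓ)) ^ c • (⊤ : Submodule (Lam ℓ) (E ⧸ Y)) :=
      Submodule.smul_mem_smul hr trivial
    rwa [hc, Submodule.mem_bot] at this
  refine ⟨c, fun x hx => ?_⟩
  rw [mem_nablaNK] at hx
  obtain ⟨a, -, b, -, rfl⟩ := hx
  exact Y.add_mem (key _ (Ideal.pow_mem_pow l_mem_max _) _)
    (key _ (Ideal.pow_le_pow_right (by omega) (omega_mem_max c)) _)

/-- The map `(a, b) ↦ ℓ^(n+k) a + ω_n b`. -/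
noncomputable def phi (ℓ : ℕ) [Fact ℓ.Prime] (E : Type*) [AddCommGroup E] [Module (Lam ℓ) E]
    (n k : ℕ) : E × E →ₗ[Lam ℓ] E :=
  ((ℓ : Lam ℓ) ^ (n + k)) • LinearMap.fst _ E E + omegaIw ℓ n • LinearMap.snd _ E E

theorem phi_apply {E : Type*} [AddCommGroup E] [Module (Lam ℓ) E] (n k : ℕ) (x : E × E) :
    phi ℓ E n k x = ((ℓ : Lam ℓ) ^ (n + k)) • x.1 + omegaIw ℓ n • x.2 := rfl

theorem nabla_eq_map_phi {E : Type*} [AddCommGroup E] [Module (Lam ℓ) E] (n k : ℕ)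
    (N : Submodule (Lam ℓ) E) : nablaNK ℓ n k N = (N.prod N).map (phi ℓ E n k) := by
  ext x
  rw [mem_nablaNK, Submodule.mem_map]
  constructor
  · rintro ⟨a, ha, b, hb, rfl⟩
    exact ⟨(a, b), ⟨ha, hb⟩, rfl⟩
  · rintro ⟨⟨a, b⟩, ⟨ha, hb⟩, rfl⟩
    exact ⟨a, ha, b, hb, rfl⟩

/-- the transfer property of relation modules -/
def GoodRel (ℓ : ℕ) [Fact ℓ.Prime] (E : Type*) [AddCommGroup E] [Module (Lam ℓ) E]
    (k : ℕ) : Prop :=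
  ∀ c, ∃ n₀, ∀ n ≥ n₀, ∀ a b : E, ((ℓ : Lam ℓ) ^ (n + k)) • a + omegaIw ℓ n • b = 0 →
    ∃ a' b' : E, ((ℓ : Lam ℓ) ^ (n + 1 + k)) • a' + omegaIw ℓ (n + 1) • b' = 0 ∧
      a - a' ∈ nablaNK ℓ c 0 (⊤ : Submodule (Lam ℓ) E) ∧
      b - b' ∈ nablaNK ℓ c 0 (⊤ : Submodule (Lam ℓ) E)

/-- stabilisation of increasing chains above a submodule of finite index -/
theorem chain_stab {E : Type*} [AddCommGroup E] [Module (Lam ℓ) E]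
    (Y : Submodule (Lam ℓ) E) [Finite (E ⧸ Y)] (W : ℕ → Submodule (Lam ℓ) E)
    (hY : ∀ n, Y ≤ W n) (n₀ : ℕ) (h : ∀ n ≥ n₀, W n ≤ W (n + 1)) :
    ∃ n₁, ∀ n ≥ n₁, W n = W n₁ := by
  have hm : Monotone fun n => W (n₀ + n) := monotone_nat_of_le_succ fun n => h _ (by omega)
  let g : ℕ →o Submodule (Lam ℓ) (E ⧸ Y) :=
    ⟨fun n => (W (n₀ + n)).map Y.mkQ, fun a b hab => Submodule.map_mono (hm hab)⟩
  obtain ⟨c, hc⟩ := monotone_stabilizes_iff_noetherian.mpr (inferInstance) g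
  refine ⟨n₀ + c, fun n hn => ?_⟩
  have h1 : (W (n₀ + c)).map Y.mkQ = (W (n₀ + (n - n₀))).map Y.mkQ := hc (n - n₀) (by omega)
  rw [show n₀ + (n - n₀) = n by omega] at h1
  have h2 := congrArg (Submodule.comap Y.mkQ) h1
  rw [Submodule.comap_map_eq, Submodule.comap_map_eq, Submodule.ker_mkQ,
    sup_eq_left.mpr (hY _), sup_eq_left.mpr (hY _)] at h2
  exact h2.symm

theorem index_const_sub {E : Type*} [AddCommGroup E] [Module (Lam ℓ) E] (k : ℕ)
    (hE : GoodRel ℓ E k) (Y : Submodule (Lam ℓ) E) [Finite (E ⧸ Y)] :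
    ∃ C : ℕ, C ≠ 0 ∧ ∃ n₁, ∀ n ≥ n₁,
      (nablaNK ℓ n k Y).toAddSubgroup.relIndex (nablaNK ℓ n k (⊤ : Submodule _ E)).toAddSubgroup
        = C := by
  obtain ⟨c, hc⟩ := nabla_le_of_finite (ℓ := ℓ) Y
  obtain ⟨n₀, hn₀⟩ := hE c
  have : Finite ((E × E) ⧸ Y.prod Y) :=
    Finite.of_injective (fun z : (E × E) ⧸ Y.prod Y =>
      (((Y.prod Y).mapQ Y (LinearMap.fst _ E E) (fun x hx => hx.1) z,
        (Y.prod Y).mapQ Y (LinearMap.snd _ E E) (fun x hx => hx.2) z) : (E ⧸ Y) × (E ⧸ Y))) (by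
      intro z w h
      induction z using Submodule.Quotient.induction_on with | _ z => ?_
      induction w using Submodule.Quotient.induction_on with | _ w => ?_
      rw [Prod.mk.injEq] at h
      rw [Submodule.Quotient.eq]
      exact ⟨(Submodule.Quotient.eq Y).mp h.1, (Submodule.Quotient.eq Y).mp h.2⟩)
  obtain ⟨n₁, hn₁⟩ := chain_stab (Y.prod Y) (fun n => Y.prod Y ⊔ LinearMap.ker (phi ℓ E n k))
    (fun n => le_sup_left) n₀ (by
      intro n hn
      refine sup_le le_sup_left ?_
      rintro ⟨a, b⟩ hab
      rw [LinearMap.mem_ker, phi_apply] at hab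
      obtain ⟨a', b', h1, h2, h3⟩ := hn₀ n hn a b hab
      rw [Submodule.mem_sup]
      exact ⟨(a - a', b - b'), ⟨hc h2, hc h3⟩, (a', b'), by
        rw [LinearMap.mem_ker, phi_apply]; exact h1, by simp⟩)
  have key : ∀ n, (nablaNK ℓ n k Y).toAddSubgroup.relIndex
      (nablaNK ℓ n k (⊤ : Submodule _ E)).toAddSubgroup =
      (Y.prod Y ⊔ LinearMap.ker (phi ℓ E n k)).toAddSubgroup.index := by
    intro n
    rw [← Submodule.comap_map_eq, ← nabla_eq_map_phi]
    have h1 : ((nablaNK ℓ n k Y).comap (phi ℓ E n k)).toAddSubgroup =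
      (nablaNK ℓ n k Y).toAddSubgroup.comap (phi ℓ E n k).toAddMonoidHom := rfl
    rw [h1, AddSubgroup.index_comap]
    congr 1
    rw [nabla_eq_map_phi]
    ext x
    simp
  refine ⟨(Y.prod Y ⊔ LinearMap.ker (phi ℓ E n₁ k)).toAddSubgroup.index, ?_, n₁,
    fun n hn => (key n).trans (by rw [hn₁ n hn])⟩
  have hfin : Finite ((E × E) ⧸ (Y.prod Y).toAddSubgroup) := this
  have h0 : (Y.prod Y).toAddSubgroup.index ≠ 0 := Nat.card_pos.ne'
  refine fun h => h0 (Nat.eq_zero_of_zero_dvd (h ▸ AddSubgroup.index_dvd_of_le ?_))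
  exact fun x hx => (le_sup_left : Y.prod Y ≤ Y.prod Y ⊔ LinearMap.ker (phi ℓ E n₁ k)) hx

theorem compare_index {E : Type*} [AddCommGroup E] [Module (Lam ℓ) E] (k : ℕ)
    (hE : GoodRel ℓ E k) {X : Type*} [AddCommGroup X] [Module (Lam ℓ) X] (t : X →ₗ[Lam ℓ] E)
    (hker : Finite (LinearMap.ker t)) (hcoker : Finite (E ⧸ LinearMap.range t)) :
    ∃ A B : ℕ, A ≠ 0 ∧ B ≠ 0 ∧ ∃ n₁, ∀ n ≥ n₁,
      (nablaNK ℓ n k (⊤ : Submodule _ X)).toAddSubgroup.index * A =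
      (nablaNK ℓ n k (⊤ : Submodule _ E)).toAddSubgroup.index * B := by
  set Y := LinearMap.range t with hY
  obtain ⟨C, hC, n₁, hn₁⟩ := index_const_sub k hE Y
  -- kernel part
  have hD : ∃ n₂, ∀ n ≥ n₂, (nablaNK ℓ n k (⊤ : Submodule _ X)) ⊓ LinearMap.ker t =
      (nablaNK ℓ n₂ k (⊤ : Submodule _ X)) ⊓ LinearMap.ker t := by
    let g : ℕ →o (Submodule (Lam ℓ) (LinearMap.ker t))ᵒᵈ :=
      ⟨fun n => OrderDual.toDual ((nablaNK ℓ n k (⊤ : Submodule _ X)).comap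
          (LinearMap.ker t).subtype),
        fun a b hab => Submodule.comap_mono (nabla_anti hab (by omega) _)⟩
    obtain ⟨c, hc⟩ := IsArtinian.monotone_stabilizes g
    refine ⟨c, fun n hn => ?_⟩
    have h1 : (nablaNK ℓ c k (⊤ : Submodule _ X)).comap (LinearMap.ker t).subtype =
      (nablaNK ℓ n k (⊤ : Submodule _ X)).comap (LinearMap.ker t).subtype := hc n hn
    have h2 := congrArg (Submodule.map (LinearMap.ker t).subtype) h1
    rw [Submodule.map_comap_subtype, Submodule.map_comap_subtype] at h2
    rw [inf_comm, ← h2, inf_comm]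
  obtain ⟨n₂, hn₂⟩ := hD
  set K := (LinearMap.ker t).toAddSubgroup with hK
  have hKf : Finite K := hker
  let D := (nablaNK ℓ n₂ k (⊤ : Submodule _ X)).toAddSubgroup.relIndex K
  have hD0 : D ≠ 0 := AddSubgroup.index_ne_zero_of_finite
  have hF : Finite (E ⧸ Y.toAddSubgroup) := hcoker
  have hYi : Y.toAddSubgroup.index ≠ 0 := Nat.card_pos.ne'
  refine ⟨Y.toAddSubgroup.index, C * D, hYi, mul_ne_zero hC hD0, max n₁ n₂, fun n hn => ?_⟩
  have hn1 : n₁ ≤ n := le_trans (le_max_left _ _) hn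
  have hn2 : n₂ ≤ n := le_trans (le_max_right _ _) hn
  set NX := (nablaNK ℓ n k (⊤ : Submodule _ X)).toAddSubgroup with hNX
  set NE := (nablaNK ℓ n k (⊤ : Submodule _ E)).toAddSubgroup with hNE
  set NY := (nablaNK ℓ n k Y).toAddSubgroup with hNY
  have e1 : NX.relIndex K = D := by
    show NX.relIndex K = (nablaNK ℓ n₂ k (⊤ : Submodule _ X)).toAddSubgroup.relIndex K
    rw [← AddSubgroup.inf_relIndex_right NX, ← AddSubgroup.inf_relIndex_right (nablaNK ℓ n₂ k (⊤ : Submodule _ X)).toAddSubgroup]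
    congr 1
    exact congrArg Submodule.toAddSubgroup (hn₂ n hn2)
  have e2 : NX.relIndex K * (K ⊔ NX).index = NX.index := by
    rw [← AddSubgroup.relIndex_sup_right, AddSubgroup.relIndex_mul_index le_sup_right]
  have hmap : NX.map t.toAddMonoidHom = NY := by
    ext x
    simp only [AddSubgroup.mem_map, hNX, hNY, Submodule.mem_toAddSubgroup, mem_nablaNK]
    constructor
    · rintro ⟨_, ⟨a, -, b, -, rfl⟩, rfl⟩
      exact ⟨t a, ⟨a, rfl⟩, t b, ⟨b, rfl⟩, by simp⟩
    · rintro ⟨_, ⟨a, rfl⟩, _, ⟨b, rfl⟩, rfl⟩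
      exact ⟨_, ⟨a, trivial, b, trivial, rfl⟩, by simp⟩
  have e3 : (K ⊔ NX).index = NY.relIndex Y.toAddSubgroup := by
    have h1 : (NX.map t.toAddMonoidHom).comap t.toAddMonoidHom = NX ⊔ K :=
      AddSubgroup.comap_map_eq _ _
    rw [sup_comm, ← h1, AddSubgroup.index_comap, hmap]
    rfl
  have hYE : NY ≤ NE := by
    intro x hx
    simp only [hNE, hNY, Submodule.mem_toAddSubgroup, mem_nablaNK] at hx ⊢
    obtain ⟨a, -, b, -, h⟩ := hx
    exact ⟨a, trivial, b, trivial, h⟩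
  have hYY : NY ≤ Y.toAddSubgroup := by
    intro x hx
    simp only [hNY, Submodule.mem_toAddSubgroup, mem_nablaNK] at hx ⊢
    obtain ⟨a, ha, b, hb, rfl⟩ := hx
    exact Y.add_mem (Y.smul_mem _ ha) (Y.smul_mem _ hb)
  have e4 := AddSubgroup.relIndex_mul_index hYE
  have e5 := AddSubgroup.relIndex_mul_index hYY
  have e6 : NY.relIndex NE = C := hn₁ n hn1
  rw [← e2, e1, e3, mul_assoc, e5, ← e4, e6]
  ring

end Aux

section Aux2
variable {ℓ : ℕ} [Fact ℓ.Prime]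

theorem exists_equiv (g : Polynomial ℤ_[ℓ]) (hg : IsDistinguishedAt ℓ g) :
    Nonempty ((Lam ℓ ⧸ Ideal.span {(g : Lam ℓ)}) ≃ₗ[ℤ_[ℓ]] (Fin g.natDegree → ℤ_[ℓ])) := by
  have hd : g.IsDistinguishedAt (IsLocalRing.maximalIdeal ℤ_[ℓ]) := by
    refine ⟨⟨fun {i} hi => ?_⟩, hg.1⟩
    rw [PadicInt.maximalIdeal_eq_span_p]
    exact hg.2 i hi
  have e1 := hd.algEquivQuotient.symm.toLinearEquiv
  have e2 := (AdjoinRoot.powerBasis' hg.1).basis.equivFun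
  exact ⟨e1.trans e2⟩

/-- `ω_n` as a polynomial -/
noncomputable def omegaPoly (ℓ : ℕ) [Fact ℓ.Prime] (n : ℕ) : Polynomial ℤ_[ℓ] :=
  (1 + Polynomial.X) ^ (ℓ ^ n) - 1

theorem omegaPoly_coe (n : ℕ) : ((omegaPoly ℓ n : Polynomial ℤ_[ℓ]) : Lam ℓ) = omegaIw ℓ n := by
  simp [omegaPoly, omegaIw]

theorem omegaPoly_monic_natDegree (n : ℕ) :
    (omegaPoly ℓ n).Monic ∧ (omegaPoly ℓ n).natDegree = ℓ ^ n := by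
  have hp : 0 < ℓ ^ n := pow_pos (Fact.out : ℓ.Prime).pos n
  have h1 : ((1 + Polynomial.X : Polynomial ℤ_[ℓ]) ^ (ℓ ^ n)).natDegree = ℓ ^ n := by
    rw [add_comm, ← Polynomial.C_1, Polynomial.natDegree_pow, Polynomial.natDegree_X_add_C, mul_one]
  have h2 : ((1 + Polynomial.X : Polynomial ℤ_[ℓ]) ^ (ℓ ^ n)).Monic := by
    rw [add_comm, ← Polynomial.C_1]
    exact (Polynomial.monic_X_add_C _).pow _
  have hlt : (1 : Polynomial ℤ_[ℓ]).degree < ((1 + Polynomial.X : Polynomial ℤ_[ℓ]) ^ (ℓ ^ n)).degree := by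
    rw [Polynomial.degree_one, Polynomial.degree_eq_natDegree h2.ne_zero, h1]
    exact_mod_cast hp
  refine ⟨h2.sub_of_left hlt, ?_⟩
  rw [omegaPoly, Polynomial.natDegree_sub_eq_left_of_natDegree_lt, h1]
  rw [h1]; simpa using hp

theorem omegaPoly_dist (n : ℕ) : IsDistinguishedAt ℓ (omegaPoly ℓ n) := by
  refine ⟨(omegaPoly_monic_natDegree n).1, fun i hi => ?_⟩
  rw [(omegaPoly_monic_natDegree n).2] at hi
  rw [Ideal.mem_span_singleton, omegaPoly, Polynomial.coeff_sub, Polynomial.coeff_one_add_X_pow]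
  rcases Nat.eq_zero_or_pos i with rfl | h
  · simp
  · rw [Polynomial.coeff_one, if_neg (by omega), sub_zero]
    exact_mod_cast Nat.cast_dvd_cast
      ((Fact.out : ℓ.Prime).dvd_choose_pow (by omega) (by omega))

theorem index_nsmul_padic (a : ℕ) :
    (nsmulAddMonoidHom (α := ℤ_[ℓ]) (ℓ ^ a)).range.index = ℓ ^ a := by
  have h : (nsmulAddMonoidHom (α := ℤ_[ℓ]) (ℓ ^ a)).range =
      (PadicInt.toZModPow (p := ℓ) a).toAddMonoidHom.ker := by
    ext x
    have : x ∈ (PadicInt.toZModPow (p := ℓ) a).toAddMonoidHom.ker ↔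
      x ∈ RingHom.ker (PadicInt.toZModPow (p := ℓ) a) := Iff.rfl
    rw [this, PadicInt.ker_toZModPow, Ideal.mem_span_singleton]
    constructor
    · rintro ⟨y, rfl⟩
      exact ⟨y, by simp⟩
    · rintro ⟨y, rfl⟩
      exact ⟨y, by simp⟩
  rw [h, AddSubgroup.index_ker]
  have hs : (PadicInt.toZModPow (p := ℓ) a).toAddMonoidHom.range = ⊤ :=
    AddMonoidHom.range_eq_top.mpr (ZMod.ringHom_surjective (PadicInt.toZModPow (p := ℓ) a))
  rw [hs]
  simp

theorem index_nsmul_pi (d a : ℕ) :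
    (nsmulAddMonoidHom (α := Fin d → ℤ_[ℓ]) (ℓ ^ a)).range.index = ℓ ^ (a * d) := by
  have h : (nsmulAddMonoidHom (α := Fin d → ℤ_[ℓ]) (ℓ ^ a)).range =
      AddSubgroup.pi Set.univ
        (fun _ : Fin d => (nsmulAddMonoidHom (α := ℤ_[ℓ]) (ℓ ^ a)).range) := by
    ext x
    constructor
    · rintro ⟨y, rfl⟩ i -
      exact ⟨y i, rfl⟩
    · intro hx
      choose y hy using fun i => hx i trivial
      exact ⟨y, funext hy⟩
  rw [h, AddSubgroup.index_pi]
  simp [index_nsmul_padic, pow_mul]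

theorem index_nsmul_quot (g : Polynomial ℤ_[ℓ]) (hg : IsDistinguishedAt ℓ g) (a : ℕ) :
    (nsmulAddMonoidHom (α := Lam ℓ ⧸ Ideal.span {(g : Lam ℓ)}) (ℓ ^ a)).range.index
      = ℓ ^ (a * g.natDegree) := by
  obtain ⟨e⟩ := exists_equiv g hg
  rw [← index_nsmul_pi, ← AddSubgroup.index_comap_of_surjective _
    (f := (e : (Lam ℓ ⧸ Ideal.span {(g : Lam ℓ)}) →+ (Fin g.natDegree → ℤ_[ℓ]))) e.surjective]
  congr 1
  ext x
  constructor
  · rintro ⟨y, rfl⟩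
    exact ⟨e y, (map_nsmul e _ y).symm⟩
  · rintro ⟨y, hy⟩
    refine ⟨e.symm y, e.injective ?_⟩
    have h1 : (ℓ ^ a) • y = e x := hy
    have h2 : e ((ℓ ^ a) • e.symm y) = (ℓ ^ a) • e (e.symm y) := map_nsmul e _ _
    rw [e.apply_symm_apply, h1] at h2
    exact h2

theorem quot_l_inj (g : Polynomial ℤ_[ℓ]) (hg : IsDistinguishedAt ℓ g) (a : ℕ)
    (x : Lam ℓ ⧸ Ideal.span {(g : Lam ℓ)}) (hx : (ℓ ^ a) • x = 0) : x = 0 := by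
  obtain ⟨e⟩ := exists_equiv g hg
  have h1 : (ℓ ^ a) • e x = 0 := by rw [← map_nsmul, hx, map_zero]
  have h2 : e x = 0 := by
    funext i
    have := congrFun h1 i
    simpa [(Fact.out : ℓ.Prime).ne_zero] using this
  exact e.injective (by rw [h2, map_zero])

theorem index_ideal (a n : ℕ) (H : AddSubgroup (Lam ℓ))
    (hH : ∀ x, x ∈ H ↔ ∃ u v, (ℓ : Lam ℓ) ^ a * u + omegaIw ℓ n * v = x) :
    H.index = ℓ ^ (a * ℓ ^ n) := by
  have h := index_nsmul_quot (omegaPoly ℓ n) (omegaPoly_dist n) a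
  rw [(omegaPoly_monic_natDegree n).2] at h
  rw [← h, ← AddSubgroup.index_comap_of_surjective _
    (f := (Ideal.Quotient.mk (Ideal.span {(omegaPoly ℓ n : Lam ℓ)})).toAddMonoidHom)
    Ideal.Quotient.mk_surjective]
  congr 1
  ext x
  rw [hH, AddSubgroup.mem_comap]
  constructor
  · rintro ⟨u, v, rfl⟩
    refine ⟨Ideal.Quotient.mk _ u, ?_⟩
    have : Ideal.Quotient.mk (Ideal.span {(omegaPoly ℓ n : Lam ℓ)}) (omegaIw ℓ n) = 0 := by
      rw [Ideal.Quotient.eq_zero_iff_mem, omegaPoly_coe]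
      exact Ideal.mem_span_singleton_self _
    simp [this]
  · rintro ⟨y, hy⟩
    obtain ⟨u, rfl⟩ := Ideal.Quotient.mk_surjective y
    have h1 : Ideal.Quotient.mk (Ideal.span {(omegaPoly ℓ n : Lam ℓ)}) (x - (ℓ : Lam ℓ) ^ a * u) = 0 := by
      rw [map_sub, sub_eq_zero]
      simpa using hy.symm
    rw [Ideal.Quotient.eq_zero_iff_mem, omegaPoly_coe, Ideal.mem_span_singleton] at h1
    obtain ⟨v, hv⟩ := h1
    exact ⟨u, v, by rw [← hv]; ring⟩

theorem omega_coprime (n N : ℕ) (a b : Lam ℓ) (h : omegaIw ℓ n * b = (ℓ : Lam ℓ) ^ N * a) :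
    ∃ c, a = omegaIw ℓ n * c ∧ b = (ℓ : Lam ℓ) ^ N * c := by
  have h1 : (ℓ ^ N) • Ideal.Quotient.mk (Ideal.span {(omegaPoly ℓ n : Lam ℓ)}) a = 0 := by
    rw [← map_nsmul, Ideal.Quotient.eq_zero_iff_mem, omegaPoly_coe, Ideal.mem_span_singleton]
    exact ⟨b, by rw [h]; simp⟩
  have h2 := quot_l_inj _ (omegaPoly_dist n) _ _ h1
  rw [Ideal.Quotient.eq_zero_iff_mem, omegaPoly_coe, Ideal.mem_span_singleton] at h2
  obtain ⟨c, rfl⟩ := h2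
  refine ⟨c, rfl, ?_⟩
  have h0 : omegaIw ℓ n ≠ 0 := by
    rw [← omegaPoly_coe]
    intro h
    exact (omegaPoly_monic_natDegree n).1.ne_zero (Polynomial.coe_eq_zero_iff.mp h)
  apply mul_left_cancel₀ h0
  rw [h]; ring

theorem good_lam (k : ℕ) : GoodRel ℓ (Lam ℓ) k := by
  intro c
  refine ⟨c, fun n hn a b hab => ⟨0, 0, by simp, ?_, ?_⟩⟩
  all_goals
    obtain ⟨d, hd, hd'⟩ := omega_coprime n (n + k) (-a) b (by
      simp only [smul_eq_mul] at hab
      linear_combination hab)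
    apply nabla_anti hn (by omega : c + 0 ≤ n + k)
    rw [mem_nablaNK, sub_zero]
  · exact ⟨0, trivial, -d, trivial, by simp only [smul_eq_mul]; linear_combination hd⟩
  · exact ⟨d, trivial, 0, trivial, by simp only [smul_eq_mul]; linear_combination -hd'⟩

theorem quot_smul (I : Ideal (Lam ℓ)) (r : Lam ℓ) (x : Lam ℓ ⧸ I) :
    r • x = Ideal.Quotient.mk I r * x := by
  obtain ⟨y, rfl⟩ := Ideal.Quotient.mk_surjective x
  rfl

theorem good_mu (m k : ℕ) : GoodRel ℓ (Lam ℓ ⧸ Ideal.span {(ℓ : Lam ℓ) ^ m}) k := by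
  intro c
  refine ⟨m, fun n hn a b hab => ⟨a, b, ?_, by simp, by simp⟩⟩
  have h0 : ∀ j, m ≤ j → ∀ x : Lam ℓ ⧸ Ideal.span {(ℓ : Lam ℓ) ^ m}, ((ℓ : Lam ℓ) ^ j) • x = 0 := by
    intro j hj x
    rw [quot_smul, (Ideal.Quotient.eq_zero_iff_mem).mpr
      (Ideal.mem_span_singleton.mpr (pow_dvd_pow _ hj)), zero_mul]
  rw [h0 _ (by omega), zero_add] at hab ⊢
  obtain ⟨d, hd⟩ := omega_dvd (ℓ := ℓ) (Nat.le_succ n)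
  rw [hd, mul_comm, mul_smul, hab, smul_zero]

theorem omega_in (f : Polynomial ℤ_[ℓ]) (hf : IsDistinguishedAt ℓ f) (N : ℕ) :
    ∃ n₀, ∀ n ≥ n₀, ∃ z : Lam ℓ ⧸ Ideal.span {(f : Lam ℓ)},
      Ideal.Quotient.mk (Ideal.span {(f : Lam ℓ)}) (omegaIw ℓ n) = (ℓ : _) ^ N * z := by
  let Y : Submodule (Lam ℓ) (Lam ℓ ⧸ Ideal.span {(f : Lam ℓ)}) := LinearMap.range (((ℓ : Lam ℓ) ^ N) • (LinearMap.id : (Lam ℓ ⧸ Ideal.span {(f : Lam ℓ)}) →ₗ[Lam ℓ] (Lam ℓ ⧸ Ideal.span {(f : Lam ℓ)})))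
  have hYe : Y.toAddSubgroup = (nsmulAddMonoidHom (α := Lam ℓ ⧸ Ideal.span {(f : Lam ℓ)}) (ℓ ^ N)).range := by
    ext x
    constructor
    · rintro ⟨y, rfl⟩
      exact ⟨y, by simp [quot_smul]⟩
    · rintro ⟨y, rfl⟩
      exact ⟨y, by simp [quot_smul]⟩
  have hYi : Y.toAddSubgroup.index ≠ 0 := by
    rw [hYe, index_nsmul_quot f hf]
    exact pow_ne_zero _ (Fact.out : ℓ.Prime).ne_zero
  have : Finite ((Lam ℓ ⧸ Ideal.span {(f : Lam ℓ)}) ⧸ Y) := Nat.finite_of_card_ne_zero hYi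
  obtain ⟨c, hc⟩ := nabla_le_of_finite Y
  refine ⟨c, fun n hn => ?_⟩
  have h1 : Ideal.Quotient.mk (Ideal.span {(f : Lam ℓ)}) (omegaIw ℓ n) ∈ Y := by
    apply hc
    obtain ⟨d, hd⟩ := omega_dvd (ℓ := ℓ) hn
    rw [mem_nablaNK]
    exact ⟨0, trivial, Ideal.Quotient.mk _ d, trivial, by rw [hd, smul_zero, zero_add, quot_smul, map_mul]⟩
  obtain ⟨z, hz⟩ := h1
  exact ⟨z, by rw [← hz]; simp [quot_smul]⟩

theorem omega_step (f : Polynomial ℤ_[ℓ]) (hf : IsDistinguishedAt ℓ f) (N : ℕ) :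
    ∃ n₀, ∀ n ≥ n₀, ∃ z : Lam ℓ ⧸ Ideal.span {(f : Lam ℓ)},
      Ideal.Quotient.mk (Ideal.span {(f : Lam ℓ)}) (omegaIw ℓ (n + 1)) =
        Ideal.Quotient.mk (Ideal.span {(f : Lam ℓ)}) (omegaIw ℓ n) * (ℓ * (1 + (ℓ : _) ^ N * z)) := by
  obtain ⟨n₀, hn₀⟩ := omega_in f hf (N + 1)
  refine ⟨n₀, fun n hn => ?_⟩
  obtain ⟨z, hz⟩ := hn₀ n hn
  obtain ⟨h, hh⟩ := omega_succ (ℓ := ℓ) n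
  refine ⟨z * Ideal.Quotient.mk _ h, ?_⟩
  rw [hh, map_mul, map_add, map_mul, map_natCast]
  congr 1
  rw [hz]; ring

theorem good_f (f : Polynomial ℤ_[ℓ]) (hf : IsDistinguishedAt ℓ f) (k : ℕ) :
    GoodRel ℓ (Lam ℓ ⧸ Ideal.span {(f : Lam ℓ)}) k := by
  intro c
  obtain ⟨n₀, hn₀⟩ := omega_step f hf c
  refine ⟨n₀, fun n hn a b hab => ?_⟩
  obtain ⟨z, hz⟩ := hn₀ n hn
  refine ⟨(1 + (ℓ : _) ^ c * z) * a, b, ?_, ?_, by simp⟩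
  · rw [quot_smul, quot_smul] at hab ⊢
    rw [hz]
    simp only [map_pow, map_natCast] at hab ⊢
    linear_combination (ℓ * (1 + (ℓ : _) ^ c * z)) * hab
  · rw [mem_nablaNK]
    refine ⟨- z * a, trivial, 0, trivial, ?_⟩
    rw [quot_smul, smul_zero]
    simp only [map_pow, map_natCast, add_zero]
    ring

end Aux2

section Aux3
variable {ℓ : ℕ} [Fact ℓ.Prime]

theorem nabla_prod {M N : Type*} [AddCommGroup M] [Module (Lam ℓ) M] [AddCommGroup N]
    [Module (Lam ℓ) N] (n k : ℕ) :
    nablaNK ℓ n k (⊤ : Submodule (Lam ℓ) (M × N)) =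
      (nablaNK ℓ n k (⊤ : Submodule (Lam ℓ) M)).prod (nablaNK ℓ n k (⊤ : Submodule (Lam ℓ) N)) := by
  ext ⟨x, y⟩
  rw [Submodule.mem_prod, mem_nablaNK, mem_nablaNK, mem_nablaNK]
  constructor
  · rintro ⟨a, -, b, -, h⟩
    exact ⟨⟨a.1, trivial, b.1, trivial, congrArg Prod.fst h⟩,
      ⟨a.2, trivial, b.2, trivial, congrArg Prod.snd h⟩⟩
  · rintro ⟨⟨a, -, b, -, h⟩, ⟨a', -, b', -, h'⟩⟩
    exact ⟨(a, a'), trivial, (b, b'), trivial, Prod.ext h h'⟩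

theorem nabla_pi {ι : Type*} {M : ι → Type*} [∀ i, AddCommGroup (M i)]
    [∀ i, Module (Lam ℓ) (M i)] (n k : ℕ) :
    nablaNK ℓ n k (⊤ : Submodule (Lam ℓ) (∀ i, M i)) =
      Submodule.pi Set.univ (fun i => nablaNK ℓ n k (⊤ : Submodule (Lam ℓ) (M i))) := by
  ext x
  rw [Submodule.mem_pi, mem_nablaNK]
  simp only [mem_nablaNK]
  constructor
  · rintro ⟨a, -, b, -, h⟩ i -
    exact ⟨a i, trivial, b i, trivial, congrFun h i⟩
  · intro h
    choose a _ b _ hab using fun i => h i trivial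
    exact ⟨a, trivial, b, trivial, funext hab⟩

theorem good_prod {M N : Type*} [AddCommGroup M] [Module (Lam ℓ) M] [AddCommGroup N]
    [Module (Lam ℓ) N] (k : ℕ) (hM : GoodRel ℓ M k) (hN : GoodRel ℓ N k) :
    GoodRel ℓ (M × N) k := by
  intro c
  obtain ⟨n₁, h₁⟩ := hM c
  obtain ⟨n₂, h₂⟩ := hN c
  refine ⟨max n₁ n₂, fun n hn a b hab => ?_⟩
  obtain ⟨a', b', e1, e2, e3⟩ := h₁ n (le_trans (le_max_left _ _) hn) a.1 b.1
    (congrArg Prod.fst hab)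
  obtain ⟨a'', b'', e1', e2', e3'⟩ := h₂ n (le_trans (le_max_right _ _) hn) a.2 b.2
    (congrArg Prod.snd hab)
  refine ⟨(a', a''), (b', b''), Prod.ext e1 e1', ?_, ?_⟩
  · rw [nabla_prod]; exact ⟨e2, e2'⟩
  · rw [nabla_prod]; exact ⟨e3, e3'⟩

theorem good_pi {ι : Type*} [Fintype ι] {M : ι → Type*} [∀ i, AddCommGroup (M i)]
    [∀ i, Module (Lam ℓ) (M i)] (k : ℕ) (h : ∀ i, GoodRel ℓ (M i) k) :
    GoodRel ℓ (∀ i, M i) k := by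
  intro c
  choose n₀ hn₀ using fun i => h i c
  refine ⟨Finset.univ.sup n₀, fun n hn a b hab => ?_⟩
  choose a' b' e1 e2 e3 using fun i => hn₀ i n
    (le_trans (Finset.le_sup (Finset.mem_univ i)) hn) (a i) (b i) (congrFun hab i)
  refine ⟨a', b', funext e1, ?_, ?_⟩
  · rw [nabla_pi]; exact fun i _ => e2 i
  · rw [nabla_pi]; exact fun i _ => e3 i

theorem index_nabla_prod {M N : Type*} [AddCommGroup M] [Module (Lam ℓ) M] [AddCommGroup N]
    [Module (Lam ℓ) N] (n k : ℕ) :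
    (nablaNK ℓ n k (⊤ : Submodule (Lam ℓ) (M × N))).toAddSubgroup.index =
      (nablaNK ℓ n k (⊤ : Submodule (Lam ℓ) M)).toAddSubgroup.index *
      (nablaNK ℓ n k (⊤ : Submodule (Lam ℓ) N)).toAddSubgroup.index := by
  rw [nabla_prod, ← AddSubgroup.index_prod]
  rfl

theorem index_nabla_pi {ι : Type*} [Fintype ι] {M : ι → Type*} [∀ i, AddCommGroup (M i)]
    [∀ i, Module (Lam ℓ) (M i)] (n k : ℕ) :
    (nablaNK ℓ n k (⊤ : Submodule (Lam ℓ) (∀ i, M i))).toAddSubgroup.index =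
      ∏ i, (nablaNK ℓ n k (⊤ : Submodule (Lam ℓ) (M i))).toAddSubgroup.index := by
  classical
  rw [nabla_pi]
  have : (Submodule.pi Set.univ
      (fun i => nablaNK ℓ n k (⊤ : Submodule (Lam ℓ) (M i)))).toAddSubgroup =
    AddSubgroup.pi Set.univ
      (fun i => (nablaNK ℓ n k (⊤ : Submodule (Lam ℓ) (M i))).toAddSubgroup) := rfl
  rw [this]
  let q : ((∀ i, M i) ⧸ (AddSubgroup.pi Set.univ
      (fun i => (nablaNK ℓ n k (⊤ : Submodule (Lam ℓ) (M i))).toAddSubgroup))) ≃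
      ∀ i, (M i ⧸ (nablaNK ℓ n k (⊤ : Submodule (Lam ℓ) (M i))).toAddSubgroup) :=
    (Submodule.quotientPi (fun i => nablaNK ℓ n k (⊤ : Submodule (Lam ℓ) (M i)))).toEquiv
  exact (Nat.card_congr q).trans Nat.card_pi

theorem index_lam (n k : ℕ) :
    (nablaNK ℓ n k (⊤ : Submodule (Lam ℓ) (Lam ℓ))).toAddSubgroup.index = ℓ ^ ((n + k) * ℓ ^ n) := by
  apply index_ideal
  intro x
  rw [Submodule.mem_toAddSubgroup, mem_nablaNK]
  simp

theorem index_mu (n k m : ℕ) (h : m ≤ n + k) :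
    (nablaNK ℓ n k (⊤ : Submodule (Lam ℓ)
      (Lam ℓ ⧸ Ideal.span {(ℓ : Lam ℓ) ^ m}))).toAddSubgroup.index = ℓ ^ (m * ℓ ^ n) := by
  rw [← AddSubgroup.index_comap_of_surjective _
    (f := (Ideal.Quotient.mk (Ideal.span {(ℓ : Lam ℓ) ^ m})).toAddMonoidHom)
    Ideal.Quotient.mk_surjective]
  apply index_ideal
  intro x
  rw [AddSubgroup.mem_comap, Submodule.mem_toAddSubgroup, mem_nablaNK]
  have h0 : ∀ x : Lam ℓ ⧸ Ideal.span {(ℓ : Lam ℓ) ^ m}, ((ℓ : Lam ℓ) ^ (n + k)) • x = 0 := by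
    intro x
    rw [quot_smul, (Ideal.Quotient.eq_zero_iff_mem).mpr
      (Ideal.mem_span_singleton.mpr (pow_dvd_pow _ h)), zero_mul]
  constructor
  · rintro ⟨a, -, b, -, e⟩
    obtain ⟨b, rfl⟩ := Ideal.Quotient.mk_surjective b
    rw [h0, zero_add, quot_smul, ← map_mul] at e
    have e' : Ideal.Quotient.mk (Ideal.span {(ℓ : Lam ℓ) ^ m}) (omegaIw ℓ n * b) =
      Ideal.Quotient.mk _ x := e
    rw [eq_comm, Ideal.Quotient.eq, Ideal.mem_span_singleton] at e'
    obtain ⟨u, hu⟩ := e'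
    exact ⟨u, b, by linear_combination -hu⟩
  · rintro ⟨u, v, rfl⟩
    refine ⟨0, trivial, Ideal.Quotient.mk _ v, trivial, ?_⟩
    rw [h0, zero_add, quot_smul, ← map_mul]
    show Ideal.Quotient.mk (Ideal.span {(ℓ : Lam ℓ) ^ m}) (omegaIw ℓ n * v) =
      Ideal.Quotient.mk _ _
    rw [eq_comm, Ideal.Quotient.eq, Ideal.mem_span_singleton]
    exact ⟨u, by ring⟩

theorem index_f_succ (f : Polynomial ℤ_[ℓ]) (hf : IsDistinguishedAt ℓ f) (k : ℕ) :
    ∃ n₀, ∀ n ≥ n₀, (nablaNK ℓ (n + 1) k (⊤ : Submodule (Lam ℓ)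
      (Lam ℓ ⧸ Ideal.span {(f : Lam ℓ)}))).toAddSubgroup.index =
      (nablaNK ℓ n k (⊤ : Submodule (Lam ℓ)
      (Lam ℓ ⧸ Ideal.span {(f : Lam ℓ)}))).toAddSubgroup.index * ℓ ^ f.natDegree := by
  obtain ⟨n₀, hn₀⟩ := omega_step f hf 1
  refine ⟨n₀, fun n hn => ?_⟩
  obtain ⟨z, hz⟩ := hn₀ n hn
  have hu : IsUnit (1 + (ℓ : Lam ℓ ⧸ Ideal.span {(f : Lam ℓ)}) ^ 1 * z) := by
    obtain ⟨y, rfl⟩ := Ideal.Quotient.mk_surjective z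
    have : IsUnit (1 + (ℓ : Lam ℓ) * y) := by
      by_contra hcon
      have h1 : (1 + (ℓ : Lam ℓ) * y) ∈ IsLocalRing.maximalIdeal (Lam ℓ) := hcon
      have h2 : (ℓ : Lam ℓ) * y ∈ IsLocalRing.maximalIdeal (Lam ℓ) :=
        Ideal.mul_mem_right _ _ l_mem_max
      have h3 := (Ideal.add_mem_iff_left _ h2).mp h1
      exact (IsLocalRing.maximalIdeal.isMaximal (Lam ℓ)).ne_top ((Ideal.eq_top_iff_one _).mpr h3)
    have h4 := this.map (Ideal.Quotient.mk (Ideal.span {(f : Lam ℓ)}))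
    simpa using h4
  obtain ⟨w, hw⟩ := hu.exists_right_inv
  have e1 : (nablaNK ℓ (n + 1) k (⊤ : Submodule (Lam ℓ)
      (Lam ℓ ⧸ Ideal.span {(f : Lam ℓ)}))).toAddSubgroup =
      (nablaNK ℓ n k (⊤ : Submodule (Lam ℓ)
      (Lam ℓ ⧸ Ideal.span {(f : Lam ℓ)}))).toAddSubgroup.map (nsmulAddMonoidHom (ℓ ^ 1)) := by
    ext x
    rw [Submodule.mem_toAddSubgroup, mem_nablaNK, AddSubgroup.mem_map]
    constructor
    · rintro ⟨a, -, b, -, rfl⟩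
      refine ⟨(ℓ : Lam ℓ) ^ (n + k) • a + omegaIw ℓ n • ((1 + (ℓ : _) ^ 1 * z) * b), ?_, ?_⟩
      · rw [Submodule.mem_toAddSubgroup, mem_nablaNK]
        exact ⟨a, trivial, _, trivial, rfl⟩
      · simp only [quot_smul, hz, map_pow, map_natCast, nsmulAddMonoidHom_apply, nsmul_eq_mul,
          Nat.cast_pow]
        ring
    · rintro ⟨y, hy, rfl⟩
      rw [Submodule.mem_toAddSubgroup, mem_nablaNK] at hy
      obtain ⟨a, -, b, -, rfl⟩ := hy
      refine ⟨a, trivial, w * b, trivial, ?_⟩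
      simp only [quot_smul, hz, map_pow, map_natCast, nsmulAddMonoidHom_apply, nsmul_eq_mul,
          Nat.cast_pow]
      linear_combination (Ideal.Quotient.mk (Ideal.span {(f : Lam ℓ)}) (omegaIw ℓ n) * ℓ * b) * hw
  have hk : (nsmulAddMonoidHom (α := Lam ℓ ⧸ Ideal.span {(f : Lam ℓ)}) (ℓ ^ 1)).ker = ⊥ := by
    rw [eq_bot_iff]
    intro x hx
    exact quot_l_inj f hf 1 x hx
  rw [e1, AddSubgroup.index_map, hk, sup_bot_eq, index_nsmul_quot f hf, one_mul]

theorem index_f_ne_zero (f : Polynomial ℤ_[ℓ]) (hf : IsDistinguishedAt ℓ f) (n k : ℕ) :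
    (nablaNK ℓ n k (⊤ : Submodule (Lam ℓ)
      (Lam ℓ ⧸ Ideal.span {(f : Lam ℓ)}))).toAddSubgroup.index ≠ 0 := by
  intro h
  have h1 := index_nsmul_quot f hf (n + k)
  have h2 : (nsmulAddMonoidHom (α := Lam ℓ ⧸ Ideal.span {(f : Lam ℓ)}) (ℓ ^ (n + k))).range ≤
    (nablaNK ℓ n k (⊤ : Submodule (Lam ℓ)
      (Lam ℓ ⧸ Ideal.span {(f : Lam ℓ)}))).toAddSubgroup := by
    rintro _ ⟨y, rfl⟩
    rw [Submodule.mem_toAddSubgroup, mem_nablaNK]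
    exact ⟨y, trivial, 0, trivial, by simp [quot_smul]⟩
  have h3 := AddSubgroup.index_dvd_of_le h2
  rw [h, h1, zero_dvd_iff] at h3
  exact pow_ne_zero _ (Fact.out : ℓ.Prime).ne_zero h3

theorem index_f (f : Polynomial ℤ_[ℓ]) (hf : IsDistinguishedAt ℓ f) (k : ℕ) :
    ∃ R : ℚ, R ≠ 0 ∧ ∃ n₀, ∀ n ≥ n₀, ((nablaNK ℓ n k (⊤ : Submodule (Lam ℓ)
      (Lam ℓ ⧸ Ideal.span {(f : Lam ℓ)}))).toAddSubgroup.index : ℚ) =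
      (ℓ : ℚ) ^ (f.natDegree * n) * R := by
  have hl : (ℓ : ℚ) ≠ 0 := by exact_mod_cast (Fact.out : ℓ.Prime).ne_zero
  obtain ⟨n₀, hn₀⟩ := index_f_succ f hf k
  refine ⟨((nablaNK ℓ n₀ k (⊤ : Submodule (Lam ℓ)
      (Lam ℓ ⧸ Ideal.span {(f : Lam ℓ)}))).toAddSubgroup.index : ℚ) / (ℓ : ℚ) ^ (f.natDegree * n₀),
      div_ne_zero (by exact_mod_cast index_f_ne_zero f hf n₀ k) (pow_ne_zero _ hl), n₀,
      fun n hn => ?_⟩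
  induction n, hn using Nat.le_induction with
  | base => field_simp
  | succ n hn ih =>
    rw [hn₀ n hn, Nat.cast_mul, ih, Nat.cast_pow]
    ring

theorem index_elem (ρ : ℕ) (ι κ : Type) [Fintype ι] [Fintype κ]
    (f : ι → Polynomial ℤ_[ℓ]) (hf : ∀ i, IsDistinguishedAt ℓ (f i)) (m : κ → ℕ) (k : ℕ) :
    ∃ R : ℚ, R ≠ 0 ∧ ∃ n₀, ∀ n ≥ n₀,
      ((nablaNK ℓ n k (⊤ : Submodule (Lam ℓ) (ElemMod ℓ ρ f m))).toAddSubgroup.index : ℚ) =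
      (ℓ : ℚ) ^ (ρ * (n + k) * ℓ ^ n + (∑ j, m j) * ℓ ^ n + (∑ i, (f i).natDegree) * n) * R := by
  choose R hR n₀ hn₀ using fun i => index_f (f i) (hf i) k
  refine ⟨∏ i, R i, Finset.prod_ne_zero_iff.mpr fun i _ => hR i,
    max (Finset.univ.sup n₀) (Finset.univ.sup m), fun n hn => ?_⟩
  have h1 : ∀ i, n₀ i ≤ n := fun i =>
    (Finset.le_sup (Finset.mem_univ i)).trans ((le_max_left _ _).trans hn)
  have h2 : ∀ j, m j ≤ n := fun j =>
    (Finset.le_sup (Finset.mem_univ j)).trans ((le_max_right _ _).trans hn)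
  rw [index_nabla_prod, index_nabla_prod, index_nabla_pi, index_nabla_pi, index_nabla_pi]
  simp only [index_lam]
  rw [Finset.prod_congr rfl fun j _ => index_mu n k (m j) ((h2 j).trans (by omega))]
  push_cast
  rw [Finset.prod_congr rfl fun i _ => hn₀ i n (h1 i)]
  rw [Finset.prod_mul_distrib]
  simp only [Finset.prod_pow_eq_pow_sum]
  rw [Finset.sum_const, Finset.card_univ, Fintype.card_fin, ← Finset.sum_mul, ← Finset.sum_mul,
    pow_add, pow_add, smul_eq_mul, mul_assoc ρ]
  ring

theorem card_pow (X : Type*) [AddCommGroup X] [Module (Lam ℓ) X] (n k : ℕ)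
    (h : Finite (X ⧸ nablaNK ℓ n k (⊤ : Submodule (Lam ℓ) X))) :
    ∃ r : ℕ, Nat.card (X ⧸ nablaNK ℓ n k (⊤ : Submodule (Lam ℓ) X)) = ℓ ^ r := by
  have hp : IsPGroup ℓ (Multiplicative (X ⧸ nablaNK ℓ n k (⊤ : Submodule (Lam ℓ) X))) := by
    intro g
    refine ⟨n + k, ?_⟩
    obtain ⟨x, hx⟩ := Submodule.Quotient.mk_surjective _ (Multiplicative.toAdd g)
    apply Multiplicative.toAdd.injective
    rw [toAdd_pow, ← hx, toAdd_one, ← Submodule.Quotient.mk_smul, Submodule.Quotient.mk_eq_zero,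
      mem_nablaNK]
    refine ⟨x, trivial, 0, trivial, ?_⟩
    rw [smul_zero, add_zero, ← Nat.cast_smul_eq_nsmul (Lam ℓ), Nat.cast_pow]
  have : Finite (Multiplicative (X ⧸ nablaNK ℓ n k (⊤ : Submodule (Lam ℓ) X))) := h
  exact hp.exists_card_eq

end Aux3

/-- For a finitely generated `Λ`-module `X` with Iwasawa invariants `ρ, μ, λ` and `k ≥ 1`,
with `∇_{n,k} = ℓ^(n+k)Λ + ω_nΛ`, the quotients `X/∇_{n,k}X` are eventually finite of
orders `ℓ^(ρ(n+k)ℓ^n + μℓ^n + λn + ν)`; i.e. the sequence is parametrized by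
`ρ`, `μ + (k−1)ρ`, `λ`. -/
theorem parameters_theorem_k (ℓ : ℕ) [Fact ℓ.Prime]
    (ρ : ℕ) (ι κ : Type) [Fintype ι] [Fintype κ]
    (f : ι → Polynomial ℤ_[ℓ]) (hf : ∀ i, IsDistinguishedAt ℓ (f i))
    (m : κ → ℕ) (hm : ∀ j, 0 < m j)
    (X : Type) [AddCommGroup X] [Module (Lam ℓ) X] [Module.Finite (Lam ℓ) X]
    (t : X →ₗ[Lam ℓ] ElemMod ℓ ρ f m)
    (hker : Finite (LinearMap.ker t))
    (hcoker : Finite (ElemMod ℓ ρ f m ⧸ LinearMap.range t))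
    (k : ℕ) (hk : 1 ≤ k) :
    ∃ (ν : ℤ) (n₀ : ℕ), ∀ n ≥ n₀,
      Finite (X ⧸ nablaNK ℓ n k (⊤ : Submodule (Lam ℓ) X)) ∧
      (Nat.card (X ⧸ nablaNK ℓ n k (⊤ : Submodule (Lam ℓ) X)) : ℚ) =
        (ℓ : ℚ) ^ (((ρ * (n + k) * ℓ ^ n + (∑ j, m j) * ℓ ^ n +
          (∑ i, (f i).natDegree) * n : ℕ) : ℤ) + ν) := by
  have hl : (ℓ : ℚ) ≠ 0 := by exact_mod_cast (Fact.out : ℓ.Prime).ne_zero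
  have hE : GoodRel ℓ (ElemMod ℓ ρ f m) k :=
    good_prod k (good_pi k fun _ => good_lam k)
      (good_prod k (good_pi k fun i => good_f (f i) (hf i) k) (good_pi k fun j => good_mu (m j) k))
  obtain ⟨A, B, hA, hB, n₁, hn₁⟩ := compare_index k hE t hker hcoker
  obtain ⟨R, hR, n₂, hn₂⟩ := index_elem ρ ι κ f hf m k
  have hA' : (A : ℚ) ≠ 0 := by exact_mod_cast hA
  have hB' : (B : ℚ) ≠ 0 := by exact_mod_cast hB
  have key : ∀ n ≥ max n₁ n₂,
      (Nat.card (X ⧸ nablaNK ℓ n k (⊤ : Submodule (Lam ℓ) X)) : ℚ) =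
        (ℓ : ℚ) ^ (ρ * (n + k) * ℓ ^ n + (∑ j, m j) * ℓ ^ n +
          (∑ i, (f i).natDegree) * n) * (R * B / A) := by
    intro n hn
    have h1 := hn₁ n (le_trans (le_max_left _ _) hn)
    have h2 := hn₂ n (le_trans (le_max_right _ _) hn)
    have h3 : (((nablaNK ℓ n k (⊤ : Submodule (Lam ℓ) X)).toAddSubgroup.index : ℕ) : ℚ) * A =
      (((nablaNK ℓ n k (⊤ : Submodule (Lam ℓ) (ElemMod ℓ ρ f m))).toAddSubgroup.index : ℕ) : ℚ) * B := by
      exact_mod_cast h1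
    rw [h2] at h3
    have h4 : Nat.card (X ⧸ nablaNK ℓ n k (⊤ : Submodule (Lam ℓ) X)) =
      (nablaNK ℓ n k (⊤ : Submodule (Lam ℓ) X)).toAddSubgroup.index := rfl
    rw [h4, mul_div_assoc', eq_div_iff hA', h3]
    ring
  have hfin : ∀ n ≥ max n₁ n₂, Finite (X ⧸ nablaNK ℓ n k (⊤ : Submodule (Lam ℓ) X)) := by
    intro n hn
    apply Nat.finite_of_card_ne_zero
    have : (Nat.card (X ⧸ nablaNK ℓ n k (⊤ : Submodule (Lam ℓ) X)) : ℚ) ≠ 0 := by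
      rw [key n hn]
      exact mul_ne_zero (pow_ne_zero _ hl) (div_ne_zero (mul_ne_zero hR hB') hA')
    exact_mod_cast this
  obtain ⟨r, hr⟩ := card_pow X (max n₁ n₂) k (hfin _ le_rfl)
  set N := max n₁ n₂ with hN
  have hS : (R * B / A : ℚ) = (ℓ : ℚ) ^ ((r : ℤ) - ((ρ * (N + k) * ℓ ^ N + (∑ j, m j) * ℓ ^ N +
          (∑ i, (f i).natDegree) * N : ℕ) : ℤ)) := by
    have h5 := key N le_rfl
    rw [hr, Nat.cast_pow] at h5
    rw [zpow_sub₀ hl, zpow_natCast, zpow_natCast, eq_div_iff (pow_ne_zero _ hl), h5]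
    ring
  refine ⟨(r : ℤ) - ((ρ * (N + k) * ℓ ^ N + (∑ j, m j) * ℓ ^ N +
          (∑ i, (f i).natDegree) * N : ℕ) : ℤ), N, fun n hn => ⟨hfin n hn, ?_⟩⟩
  rw [key n hn, hS, zpow_add₀ hl, zpow_natCast]
end
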